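/- A Helly circular-arc (HCA) graph is a normal Helly circular-arc (NHCA) graph if and only if it contains no induced subgraph isomorphic to a wheel W_n (n ≥ 4), the 3-sun S_3, a rising sun R_n (n ≥ 4), or the umbrella. -/

import Mathlib

open Set

noncomputable section

instance : Fact ((0:ℝ) < 1) := ⟨one_pos⟩

/-- A point on the circle (of circumference 1). -/
abbrev Circ : Type := AddCircle (1 : ℝ)

/-- An arc of the circle, described by its beginning point `s` and its ending point `t`
(the arc is traversed clockwise, i.e. in the positive circular direction, from `s` to `t`). -/
structure Arc where
  s : Circ
  t : Circ

/-- The set of points of the open arc: the points strictly between `s` and `t`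
in the circular order. -/
def Arc.pts (A : Arc) : Set Circ := {x | sbtw A.s x A.t}

/-- The length of an arc: the representative in `(0, 1]` of `t - s`. -/
def Arc.length (A : Arc) : ℝ := ((AddCircle.equivIoc (1:ℝ) 0) (A.t - A.s) : ℝ)

/-- A circular-arc (CA) model: a finite family of arcs of the circle such that all
endpoints of the arcs are pairwise distinct (in particular each arc has two distinct
endpoints, hence no arc covers the whole circle). -/
structure CAModel (V : Type) [Fintype V] where
  arc : V → Arc
  endpoints_distinct : Function.Injective
    (fun p : V × Bool => if p.2 then (arc p.1).s else (arc p.1).t)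

namespace CAModel

variable {V : Type} [Fintype V]

/-- The arcs of `u` and `v` intersect. -/
def Inter (M : CAModel V) (u v : V) : Prop := ((M.arc u).pts ∩ (M.arc v).pts).Nonempty

/-- The intersection graph of the model: two distinct arcs are adjacent iff they have
nonempty intersection. -/
def interGraph (M : CAModel V) : SimpleGraph V :=
  SimpleGraph.fromRel fun u v => M.Inter u v

/-- `M` is a model of the graph `G`: the arcs are in correspondence with the vertices of `G`
and two vertices are adjacent iff their arcs are distinct and intersect. -/
def IsModelOf (M : CAModel V) (G : SimpleGraph V) : Prop :=
  ∀ u v, G.Adj u v ↔ u ≠ v ∧ M.Inter u v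

/-- Helly model: every subfamily of pairwise intersecting arcs has a common point. -/
def Helly (M : CAModel V) : Prop :=
  ∀ S : Set V, (∀ u ∈ S, ∀ v ∈ S, M.Inter u v) → ∃ p : Circ, ∀ v ∈ S, p ∈ (M.arc v).pts

/-- Normal model: no two arcs together cover the whole circle. -/
def Normal (M : CAModel V) : Prop :=
  ∀ u v : V, u ≠ v → (M.arc u).pts ∪ (M.arc v).pts ≠ Set.univ

/-- No three arcs together cover the whole circle. -/
def NoThreeCover (M : CAModel V) : Prop :=
  ∀ u v w : V, u ≠ v → u ≠ w → v ≠ w →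
    (M.arc u).pts ∪ (M.arc v).pts ∪ (M.arc w).pts ≠ Set.univ

/-- Proper model: no arc is properly contained in another arc. -/
def Proper (M : CAModel V) : Prop :=
  ∀ u v : V, u ≠ v → ¬ (M.arc u).pts ⊂ (M.arc v).pts

/-- Unit model: all arcs have the same length. -/
def IsUnit (M : CAModel V) : Prop :=
  ∀ u v : V, (M.arc u).length = (M.arc v).length

/-- Interval model: some point of the circle is covered by no arc. -/
def IsIntervalModel (M : CAModel V) : Prop :=
  ∃ p : Circ, ∀ v : V, p ∉ (M.arc v).pts

/-- A universal arc: it intersects every other arc of the model. -/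
def UniversalArc (M : CAModel V) (v : V) : Prop :=
  ∀ w, w ≠ v → M.Inter v w

end CAModel

section GraphClasses

variable {V : Type} [Fintype V]

def IsCAGraph (G : SimpleGraph V) : Prop := ∃ M : CAModel V, M.IsModelOf G
def IsHCAGraph (G : SimpleGraph V) : Prop := ∃ M : CAModel V, M.Helly ∧ M.IsModelOf G
def IsNCAGraph (G : SimpleGraph V) : Prop := ∃ M : CAModel V, M.Normal ∧ M.IsModelOf G
def IsNHCAGraph (G : SimpleGraph V) : Prop :=
  ∃ M : CAModel V, M.Normal ∧ M.Helly ∧ M.IsModelOf G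
def IsPCAGraph (G : SimpleGraph V) : Prop := ∃ M : CAModel V, M.Proper ∧ M.IsModelOf G
def IsNPCAGraph (G : SimpleGraph V) : Prop :=
  ∃ M : CAModel V, M.Normal ∧ M.Proper ∧ M.IsModelOf G
def IsPHCAGraph (G : SimpleGraph V) : Prop :=
  ∃ M : CAModel V, M.Proper ∧ M.Helly ∧ M.IsModelOf G
def IsUCAGraph (G : SimpleGraph V) : Prop := ∃ M : CAModel V, M.IsUnit ∧ M.IsModelOf G
def IsUHCAGraph (G : SimpleGraph V) : Prop :=
  ∃ M : CAModel V, M.IsUnit ∧ M.Helly ∧ M.IsModelOf G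
def IsIntervalGraph (G : SimpleGraph V) : Prop :=
  ∃ M : CAModel V, M.IsIntervalModel ∧ M.IsModelOf G

end GraphClasses
/-! ### Some small graphs -/

/-- The claw `K_{1,3}`: vertex `0` is adjacent to `1`, `2`, `3`, which are pairwise
non-adjacent. -/
def claw : SimpleGraph (Fin 4) := SimpleGraph.fromRel fun u _ => u = 0

/-- The `n`-wheel `W_n`: a chordless cycle on `n` vertices plus one extra vertex adjacent
to all of them (intended for `n ≥ 4`). -/
def wheel (n : ℕ) : SimpleGraph (Fin n ⊕ Unit) :=
  SimpleGraph.fromRel fun u v =>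
    (∃ x, u = Sum.inr x) ∨
    (∃ i j : Fin n, u = Sum.inl i ∧ v = Sum.inl j ∧ ((i : ℕ) + 1) % n = (j : ℕ))

/-- The 3-sun `S_3`: vertices `0,1,2` (the `v_i`'s) are pairwise adjacent, vertices
`3,4,5` (the `w_i`'s) are pairwise non-adjacent, and `w_i` is adjacent exactly to
`v_i` and `v_{i+1 (mod 3)}`. -/
def sun3 : SimpleGraph (Fin 6) :=
  SimpleGraph.fromRel fun u v =>
    ((u : ℕ) < 3 ∧ (v : ℕ) < 3) ∨
    (3 ≤ (u : ℕ) ∧ ((v : ℕ) = (u : ℕ) - 3 ∨ (v : ℕ) = ((u : ℕ) - 2) % 3))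

/-- The tent: the complement of the 3-sun. -/
def tent : SimpleGraph (Fin 6) := sun3ᶜ

/-- The `n`-rising sun `R_n` (intended for `n ≥ 4`): vertices `inl 0, …, inl (n-1)`
are `v_1, …, v_n` where `v_2, …, v_{n-1}` form a path in this order and `v_1`, `v_n`
are adjacent to all the `v`'s; `inr 0 = w_1` is adjacent exactly to `v_1, v_2`;
`inr 1 = w_{n-1}` is adjacent exactly to `v_{n-1}, v_n`; and `inr 2 = w_n` is adjacent
exactly to `v_n, v_1`. -/
def risingSun (n : ℕ) : SimpleGraph (Fin n ⊕ Fin 3) :=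
  SimpleGraph.fromRel fun u v =>
    match u, v with
    | Sum.inl a, Sum.inl b => (a : ℕ) = 0 ∨ (a : ℕ) = n - 1 ∨ (b : ℕ) = (a : ℕ) + 1
    | Sum.inr w, Sum.inl a =>
        ((w : ℕ) = 0 ∧ ((a : ℕ) = 0 ∨ (a : ℕ) = 1)) ∨
        ((w : ℕ) = 1 ∧ ((a : ℕ) = n - 2 ∨ (a : ℕ) = n - 1)) ∨
        ((w : ℕ) = 2 ∧ ((a : ℕ) = n - 1 ∨ (a : ℕ) = 0))
    | _, _ => False

/-- The umbrella: a path `0,1,2,3,4`, a vertex `5` adjacent to all of `0,…,4`, and a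
vertex `6` adjacent only to `2`. -/
def umbrella : SimpleGraph (Fin 7) :=
  SimpleGraph.fromRel fun u v =>
    ((u : ℕ) < 5 ∧ (v : ℕ) = (u : ℕ) + 1 ∧ (v : ℕ) < 5) ∨
    ((u : ℕ) = 5 ∧ (v : ℕ) < 5) ∨
    ((u : ℕ) = 6 ∧ (v : ℕ) = 2)

/-- Coordinate of `x` with respect to base point `g`. -/
def coo (g x : Circ) : ℝ := ((AddCircle.equivIco (1:ℝ) 0) (x - g) : ℝ)

lemma coo_nonneg (g x : Circ) : 0 ≤ coo g x := ((AddCircle.equivIco (1:ℝ) 0) (x - g)).2.1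

lemma coo_lt_one (g x : Circ) : coo g x < 1 := by
  have := ((AddCircle.equivIco (1:ℝ) 0) (x - g)).2.2
  simpa [coo] using this

lemma coo_inj {g x y : Circ} (h : coo g x = coo g y) : x = y := by
  have h1 := Subtype.ext h
  have := (AddCircle.equivIco (1:ℝ) 0).injective h1
  exact sub_left_injective this

lemma coo_coe (g : Circ) (x : Circ) : ((coo g x : ℝ) : Circ) = x - g :=
  (AddCircle.equivIco (1:ℝ) 0).symm_apply_apply (x - g)

lemma coo_of (g : Circ) {r : ℝ} (h0 : 0 ≤ r) (h1 : r < 1) : coo g ((r : Circ) + g) = r := by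
  have : (AddCircle.equivIco (1:ℝ) 0) ((r : Circ) + g - g) = ⟨r, h0, by simpa using h1⟩ := by
    rw [add_sub_cancel_right]
    exact (AddCircle.equivIco (1:ℝ) 0).apply_symm_apply ⟨r, h0, by simpa using h1⟩
  exact congrArg Subtype.val this

lemma coo_self (g : Circ) : coo g g = 0 := by
  have := coo_of g (r := 0) le_rfl one_pos
  simpa using this

lemma coo_surj (g : Circ) {r : ℝ} (h0 : 0 ≤ r) (h1 : r < 1) : ∃ x, coo g x = r :=
  ⟨_, coo_of g h0 h1⟩

lemma toIcoMod_small {a b : ℝ} (ha : 0 ≤ a) (ha1 : a < 1) (hb : 0 ≤ b) (hb1 : b < 1) :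
    toIcoMod (one_pos : (0:ℝ) < 1) a b = if a ≤ b then b else b + 1 := by
  rw [toIcoMod_eq_iff]
  split_ifs with h
  · exact ⟨⟨h, by linarith⟩, 0, by simp⟩
  · push Not at h
    exact ⟨⟨by linarith, by linarith⟩, -1, by simp⟩

lemma toIocMod_small {a b : ℝ} (ha : 0 ≤ a) (ha1 : a < 1) (hb : 0 ≤ b) (hb1 : b < 1) :
    toIocMod (one_pos : (0:ℝ) < 1) a b = if a < b then b else b + 1 := by
  rw [toIocMod_eq_iff]
  split_ifs with h
  · exact ⟨⟨h, by linarith⟩, 0, by simp⟩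
  · push Not at h
    exact ⟨⟨by linarith, by linarith⟩, -1, by simp⟩

lemma btw_coo_aux {a b c : ℝ} (ha : 0 ≤ a) (ha1 : a < 1) (hb : 0 ≤ b) (hb1 : b < 1)
    (hc : 0 ≤ c) (hc1 : c < 1) : btw (a : Circ) (b : Circ) (c : Circ) ↔
      (if a ≤ b then b else b + 1) ≤ (if a < c then c else c + 1) := by
  have h := @QuotientAddGroup.btw_coe_iff ℝ _ _ _ _ 1 _ a b c
  rw [toIcoMod_small ha ha1 hb hb1, toIocMod_small ha ha1 hc hc1] at h
  exact h

lemma btw_sub (g a b c : Circ) : btw a b c ↔ btw (a - g) (b - g) (c - g) := by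
  induction a using QuotientAddGroup.induction_on
  induction b using QuotientAddGroup.induction_on
  induction c using QuotientAddGroup.induction_on
  induction g using QuotientAddGroup.induction_on
  rename_i a b c g
  rw [← QuotientAddGroup.mk_sub, ← QuotientAddGroup.mk_sub, ← QuotientAddGroup.mk_sub]
  have h := @QuotientAddGroup.btw_coe_iff' ℝ _ _ _ _ 1 _ a b c
  have h' := @QuotientAddGroup.btw_coe_iff' ℝ _ _ _ _ 1 _ (a - g) (b - g) (c - g)
  rw [sub_sub_sub_cancel_right, sub_sub_sub_cancel_right] at h'
  exact h.trans h'.symm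

lemma sbtw_coo (g a b c : Circ) : sbtw a b c ↔
    (coo g a < coo g b ∧ coo g b < coo g c) ∨ (coo g b < coo g c ∧ coo g c < coo g a) ∨
    (coo g c < coo g a ∧ coo g a < coo g b) := by
  rw [sbtw_iff_btw_not_btw, btw_sub g a b c, btw_sub g c b a, ← coo_coe, ← coo_coe, ← coo_coe]
  have a0 := coo_nonneg g a
  have a1 := coo_lt_one g a
  have b0 := coo_nonneg g b
  have b1 := coo_lt_one g b
  have c0 := coo_nonneg g c
  have c1 := coo_lt_one g c
  generalize coo g a = a at *
  generalize coo g b = b at *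
  generalize coo g c = c at *
  rw [btw_coo_aux a0 a1 b0 b1 c0 c1, btw_coo_aux c0 c1 b0 b1 a0 a1]
  split_ifs <;> grind



/-- Membership in an arc in coordinates. -/
def arcR (s t x : ℝ) : Prop := (s < x ∧ x < t) ∨ (x < t ∧ t < s) ∨ (t < s ∧ s < x)

namespace CAModel
variable {V : Type} [Fintype V] (M : CAModel V)

/-- points of the arc of `v` -/
def P (v : V) : Set Circ := (M.arc v).pts
/-- coordinate of start -/
def S (g : Circ) (v : V) : ℝ := coo g (M.arc v).s
/-- coordinate of end -/
def T (g : Circ) (v : V) : ℝ := coo g (M.arc v).t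
/-- start -/
def ps (v : V) : Circ := (M.arc v).s
/-- end point -/
def pt (v : V) : Circ := (M.arc v).t

lemma mem_P (g : Circ) (v : V) (p : Circ) : p ∈ M.P v ↔ arcR (M.S g v) (M.T g v) (coo g p) :=
  sbtw_coo g _ _ _

lemma coo_ps (g : Circ) (v : V) : coo g (M.ps v) = M.S g v := rfl
lemma coo_pt (g : Circ) (v : V) : coo g (M.pt v) = M.T g v := rfl

lemma ps_ne_pt (u v : V) : M.ps u ≠ M.pt v := by
  intro h
  have := M.endpoints_distinct (a₁ := (u, true)) (a₂ := (v, false)) (by simpa [ps, pt] using h)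
  simp at this

lemma ps_inj {u v : V} (h : M.ps u = M.ps v) : u = v := by
  have := M.endpoints_distinct (a₁ := (u, true)) (a₂ := (v, true)) (by simpa [ps, pt] using h)
  simpa using this

lemma pt_inj {u v : V} (h : M.pt u = M.pt v) : u = v := by
  have := M.endpoints_distinct (a₁ := (u, false)) (a₂ := (v, false)) (by simpa [ps, pt] using h)
  simpa using this

lemma S_ne_T (g : Circ) (u v : V) : M.S g u ≠ M.T g v := fun h => M.ps_ne_pt u v (coo_inj h)
lemma T_ne_S (g : Circ) (u v : V) : M.T g u ≠ M.S g v := fun h => M.ps_ne_pt v u (coo_inj h.symm)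
lemma S_inj (g : Circ) {u v : V} (h : M.S g u = M.S g v) : u = v := M.ps_inj (coo_inj h)
lemma T_inj (g : Circ) {u v : V} (h : M.T g u = M.T g v) : u = v := M.pt_inj (coo_inj h)
lemma S_nonneg (g : Circ) (v : V) : 0 ≤ M.S g v := coo_nonneg _ _
lemma T_nonneg (g : Circ) (v : V) : 0 ≤ M.T g v := coo_nonneg _ _
lemma S_lt (g : Circ) (v : V) : M.S g v < 1 := coo_lt_one _ _
lemma T_lt (g : Circ) (v : V) : M.T g v < 1 := coo_lt_one _ _

/-- basic facts of one arc -/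
lemma facts (g : Circ) (v : V) : 0 ≤ M.S g v ∧ 0 ≤ M.T g v ∧ M.S g v < 1 ∧ M.T g v < 1 ∧
    M.S g v ≠ M.T g v :=
  ⟨M.S_nonneg g v, M.T_nonneg g v, M.S_lt g v, M.T_lt g v, M.S_ne_T g v v⟩

lemma facts2 (g : Circ) {u v : V} (h : u ≠ v) : M.S g u ≠ M.S g v ∧ M.T g u ≠ M.T g v ∧
    M.S g u ≠ M.T g v ∧ M.T g u ≠ M.S g v :=
  ⟨fun e => h (M.S_inj g e), fun e => h (M.T_inj g e), M.S_ne_T g u v, M.T_ne_S g u v⟩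

lemma inter_iff (u v : V) : M.Inter u v ↔ ∃ p, p ∈ M.P u ∧ p ∈ M.P v := Iff.rfl

lemma inter_symm {u v : V} (h : M.Inter u v) : M.Inter v u := by
  obtain ⟨p, h1, h2⟩ := h
  exact ⟨p, h2, h1⟩

lemma base_mem (g : Circ) (v : V) : g ∈ M.P v ↔ arcR (M.S g v) (M.T g v) 0 := by
  rw [M.mem_P g, coo_self]

lemma base_mem' {g : Circ} {v : V} : g ∈ M.P v ↔ 0 < M.T g v ∧ M.T g v < M.S g v := by
  have := M.facts g v
  rw [base_mem, arcR]; grind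

lemma ps_notMem (v : V) : M.ps v ∉ M.P v := by
  rw [M.mem_P 0, coo_ps, arcR]; grind
lemma pt_notMem (v : V) : M.pt v ∉ M.P v := by
  rw [M.mem_P 0, coo_pt, arcR]; grind

lemma exists_coo (g : Circ) {v : V} {x : ℝ} (h0 : 0 ≤ x) (h1 : x < 1)
    (h : arcR (M.S g v) (M.T g v) x) : ∃ p ∈ M.P v, coo g p = x := by
  obtain ⟨p, hp⟩ := coo_surj g h0 h1
  exact ⟨p, by rw [M.mem_P g, hp]; exact h, hp⟩

lemma inter_self (v : V) : M.Inter v v := by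
  have hf := M.facts (M.ps v) v
  have hs : M.S (M.ps v) v = 0 := coo_self _
  obtain ⟨p, hp, -⟩ := M.exists_coo (M.ps v) (v := v) (x := M.T (M.ps v) v / 2)
    (by linarith) (by linarith) (by left; rw [hs]; rw [hs] at hf; have : 0 < M.T (M.ps v) v := by grind
                                    constructor <;> linarith)
  exact ⟨p, hp, hp⟩

lemma inter_of_ps {u v : V} (h : M.ps u ∈ M.P v) : M.Inter u v := by
  by_cases huv : u = v
  · subst huv; exact M.inter_self u
  have hu := M.facts (M.ps u) u
  have hv := M.facts (M.ps u) v
  have h2 := M.facts2 (M.ps u) huv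
  have hs : M.S (M.ps u) u = 0 := coo_self _
  rw [base_mem'] at h
  have hx : 0 < min (M.T (M.ps u) u) (M.T (M.ps u) v) := by
    apply lt_min <;> grind
  obtain ⟨p, hp⟩ := coo_surj (M.ps u) (r := min (M.T (M.ps u) u) (M.T (M.ps u) v) / 2)
    (by linarith) (by have := min_le_left (M.T (M.ps u) u) (M.T (M.ps u) v); linarith)
  have h3 := min_le_left (M.T (M.ps u) u) (M.T (M.ps u) v)
  have h4 := min_le_right (M.T (M.ps u) u) (M.T (M.ps u) v)
  refine ⟨p, (M.mem_P (M.ps u) u p).2 ?_, (M.mem_P (M.ps u) v p).2 ?_⟩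
  · rw [hp, arcR]; left; rw [hs]; constructor <;> linarith
  · rw [hp, arcR]; right; left; constructor <;> linarith

lemma inter_of_pt {u v : V} (h : M.pt u ∈ M.P v) : M.Inter u v := by
  by_cases huv : u = v
  · subst huv; exact M.inter_self u
  have hu := M.facts (M.pt u) u
  have hv := M.facts (M.pt u) v
  have h2 := M.facts2 (M.pt u) huv
  have hs : M.T (M.pt u) u = 0 := coo_self _
  rw [base_mem'] at h
  have h3 := le_max_left (M.S (M.pt u) u) (M.S (M.pt u) v)
  have h4 := le_max_right (M.S (M.pt u) u) (M.S (M.pt u) v)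
  have h5 : max (M.S (M.pt u) u) (M.S (M.pt u) v) < 1 := max_lt hu.2.2.1 hv.2.2.1
  obtain ⟨p, hp⟩ := coo_surj (M.pt u) (r := (1 + max (M.S (M.pt u) u) (M.S (M.pt u) v)) / 2)
    (by linarith) (by linarith)
  refine ⟨p, (M.mem_P (M.pt u) u p).2 ?_, (M.mem_P (M.pt u) v p).2 ?_⟩
  · rw [hp, arcR]; right; right; constructor
    · rw [hs]; grind
    · linarith
  · rw [hp, arcR]; right; right; constructor <;> linarith

lemma of_inter {u v : V} (h : M.Inter u v) : u = v ∨ M.ps u ∈ M.P v ∨ M.ps v ∈ M.P u := by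
  by_cases huv : u = v
  · exact Or.inl huv
  right
  obtain ⟨p, h1, h2⟩ := h
  have h1 : p ∈ M.P u := h1
  have h2 : p ∈ M.P v := h2
  have hu := M.facts p u
  have hv := M.facts p v
  have h3 := M.facts2 p huv
  rw [base_mem'] at h1 h2
  rw [M.mem_P p, M.mem_P p, coo_ps, coo_ps, arcR, arcR]
  grind

lemma of_inter' {u v : V} (h : M.Inter u v) : u = v ∨ M.pt u ∈ M.P v ∨ M.pt v ∈ M.P u := by
  by_cases huv : u = v
  · exact Or.inl huv
  right
  obtain ⟨p, h1, h2⟩ := h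
  have h1 : p ∈ M.P u := h1
  have h2 : p ∈ M.P v := h2
  have hu := M.facts p u
  have hv := M.facts p v
  have h3 := M.facts2 p huv
  rw [base_mem'] at h1 h2
  rw [M.mem_P p, M.mem_P p, coo_pt, coo_pt, arcR, arcR]
  grind

/-- two arcs cover the circle -/
def Cov (u v : V) : Prop := ∀ p, p ∈ M.P u ∨ p ∈ M.P v

variable {M}

lemma Cov.symm {u v : V} (h : M.Cov u v) : M.Cov v u := fun p => (h p).symm

lemma cov_iff_union {u v : V} : M.Cov u v ↔ (M.arc u).pts ∪ (M.arc v).pts = Set.univ := by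
  rw [Set.eq_univ_iff_forall]; rfl

lemma Cov.ne {u v : V} (h : M.Cov u v) : u ≠ v := by
  rintro rfl
  have := h (M.ps u)
  have := M.ps_notMem u
  tauto

lemma Cov.inter {u v : V} (h : M.Cov u v) : M.Inter u v := by
  apply M.inter_of_ps
  have := h (M.ps u)
  have := M.ps_notMem u
  tauto

end CAModel

open Relation



lemma exists_chain {α : Type} {R : α → α → Prop} {x y : α} (h : ReflTransGen R x y) :
    ∃ (m : ℕ) (f : ℕ → α), f 0 = x ∧ f m = y ∧ ∀ i < m, R (f i) (f (i+1)) := by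
  induction h with
  | refl => exact ⟨0, fun _ => x, rfl, rfl, by simp⟩
  | @tail b c hab hbc ih =>
    obtain ⟨m, f, h0, hm, hR⟩ := ih
    refine ⟨m+1, fun i => if i ≤ m then f i else c, by simp [h0], by simp, ?_⟩
    intro i hi
    rcases Nat.lt_or_ge i m with h | h
    · have h1 : i ≤ m := by omega
      have h2 : i + 1 ≤ m := by omega
      simp only [h1, h2, if_true]; exact hR i h
    · have : i = m := by omega
      subst this
      simp [hm, hbc]

lemma exists_shortest {α : Type} (R : α → α → Prop) (A B : α → Prop)
    (h : ∃ x y, A x ∧ B y ∧ ReflTransGen R x y) :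
    ∃ (m : ℕ) (f : ℕ → α), A (f 0) ∧ B (f m) ∧ (∀ i < m, R (f i) (f (i+1))) ∧
      (∀ i j, i + 1 < j → j ≤ m → ¬ R (f i) (f j)) ∧ (∀ i, 0 < i → i ≤ m → ¬ A (f i)) ∧
      (∀ i, i < m → ¬ B (f i)) ∧ (∀ i j, i < j → j ≤ m → f i ≠ f j) := by
  have hex : ∃ m, ∃ f : ℕ → α, A (f 0) ∧ B (f m) ∧ (∀ i < m, R (f i) (f (i+1))) := by
    obtain ⟨x, y, hx, hy, hxy⟩ := h
    obtain ⟨m, f, h0, hm, hR⟩ := exists_chain hxy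
    exact ⟨m, f, h0 ▸ hx, hm ▸ hy, hR⟩
  classical
  obtain ⟨f, hA, hB, hR⟩ := Nat.find_spec hex
  have hmin : ∀ k < Nat.find hex, ∀ f : ℕ → α, A (f 0) → B (f k) →
      (∀ i < k, R (f i) (f (i+1))) → False :=
    fun k hk f h1 h2 h3 => Nat.find_min hex hk ⟨f, h1, h2, h3⟩
  generalize Nat.find hex = m at *
  refine ⟨m, f, hA, hB, hR, ?_, ?_, ?_, ?_⟩
  · intro i j hij hj hRij
    refine hmin (m - (j - i - 1)) (by omega)
      (fun t => if t ≤ i then f t else f (t + (j - i - 1))) (by simpa using hA) ?_ ?_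
    · have h1 : ¬ (m - (j - i - 1) ≤ i) := by omega
      have h2 : m - (j - i - 1) + (j - i - 1) = m := by omega
      simp only [h1, if_false, h2]; exact hB
    · intro t ht
      rcases lt_trichotomy t i with h | h | h
      · have h1 : t ≤ i := by omega
        have h2 : t + 1 ≤ i := by omega
        simp only [h1, h2, if_true]; exact hR t (by omega)
      · subst h
        have h2 : ¬ (t + 1 ≤ t) := by omega
        have h3 : t + 1 + (j - t - 1) = j := by omega
        simp only [le_refl, if_true, h2, if_false, h3]; exact hRij
      · have h1 : ¬ t ≤ i := by omega
        have h2 : ¬ t + 1 ≤ i := by omega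
        have h3 : t + 1 + (j - i - 1) = t + (j - i - 1) + 1 := by omega
        simp only [h1, h2, if_false, h3]; exact hR _ (by omega)
  · intro i h0 hi hAi
    refine hmin (m - i) (by omega) (fun t => f (t + i)) (by simpa using hAi) ?_ ?_
    · have : m - i + i = m := by omega
      simpa [this] using hB
    · intro t ht
      have : t + 1 + i = t + i + 1 := by omega
      simp only [this]; exact hR _ (by omega)
  · intro i hi hBi
    exact hmin i hi f hA hBi (fun t ht => hR t (by omega))
  · intro i j hij hj he
    refine hmin (m - (j - i)) (by omega)
      (fun t => if t ≤ i then f t else f (t + (j - i))) (by simpa using hA) ?_ ?_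
    · by_cases h1 : m - (j - i) ≤ i
      · have h2 : m - (j - i) = i := by omega
        have h3 : j = m := by omega
        simp only [h2, le_refl, if_true]
        rw [he, h3]; exact hB
      · have h2 : m - (j - i) + (j - i) = m := by omega
        simp only [h1, if_false, h2]; exact hB
    · intro t ht
      rcases lt_trichotomy t i with h | h | h
      · have h1 : t ≤ i := by omega
        have h2 : t + 1 ≤ i := by omega
        simp only [h1, h2, if_true]; exact hR t (by omega)
      · subst h
        have h2 : ¬ (t + 1 ≤ t) := by omega
        have h3 : t + 1 + (j - t) = j + 1 := by omega
        simp only [le_refl, if_true, h2, if_false, h3]; rw [he]; exact hR j (by omega)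
      · have h1 : ¬ t ≤ i := by omega
        have h2 : ¬ t + 1 ≤ i := by omega
        have h3 : t + 1 + (j - i) = t + (j - i) + 1 := by omega
        simp only [h1, h2, if_false, h3]; exact hR _ (by omega)

lemma exists_exit {α : Type} {R : α → α → Prop} {P : α → Prop} {a c : α}
    (h : ReflTransGen R a c) (ha : P a) (hc : ¬ P c) :
    ∃ a' p, ReflTransGen (fun x y => R x y ∧ P x ∧ P y) a a' ∧ P a' ∧ R a' p ∧ ¬ P p := by
  by_contra hcon
  have key : ∀ d, ReflTransGen R a d →
      P d ∧ ReflTransGen (fun x y => R x y ∧ P x ∧ P y) a d := by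
    intro d hd
    induction hd with
    | refl => exact ⟨ha, .refl⟩
    | @tail b d hab hbd hb =>
      by_cases hd : P d
      · exact ⟨hd, hb.2.tail ⟨hbd, hb.1, hd⟩⟩
      · exact absurd ⟨b, d, hb.2, hb.1, hbd, hd⟩ hcon
  exact hc (key c h).1

section graph
variable {V : Type} (G : SimpleGraph V)

/-- distinct and non-adjacent -/
def Miss (u v : V) : Prop := u ≠ v ∧ ¬ G.Adj u v

/-- connected avoiding the closed neighbourhood of `c` -/
def Conn (c u v : V) : Prop :=
  ReflTransGen (fun x y => G.Adj x y ∧ Miss G c x ∧ Miss G c y) u v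

/-- asteroidal triple -/
def AT (a b c : V) : Prop :=
  Miss G a b ∧ Miss G a c ∧ Miss G b c ∧ Conn G c a b ∧ Conn G b a c ∧ Conn G a b c

/-- chordless cycle -/
def IsHole (n : ℕ) (u : ℕ → V) : Prop :=
  4 ≤ n ∧ (∀ i j, i < j → j < n → u i ≠ u j) ∧
    ∀ i j, i < j → j < n → (G.Adj (u i) (u j) ↔ j = i + 1 ∨ (i = 0 ∧ j = n - 1))

/-- no chordless cycle of length at least four -/
def NoHole : Prop := ∀ n u, ¬ IsHole G n u

variable {G}

lemma Miss.symm {u v : V} (h : Miss G u v) : Miss G v u := ⟨h.1.symm, fun h' => h.2 h'.symm⟩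

lemma Conn.symm {c u v : V} (h : Conn G c u v) : Conn G c v u := by
  unfold Conn at *
  rw [← reflTransGen_swap]
  induction h with
  | refl => exact .refl
  | tail _ h1 ih => exact ih.tail ⟨h1.1.symm, h1.2.2, h1.2.1⟩

lemma AT.swap12 {a b c : V} (h : AT G a b c) : AT G b a c :=
  ⟨h.1.symm, h.2.2.1, h.2.1, h.2.2.2.1.symm, h.2.2.2.2.2, h.2.2.2.2.1⟩
lemma AT.swap23 {a b c : V} (h : AT G a b c) : AT G a c b :=
  ⟨h.2.1, h.1, h.2.2.1.symm, h.2.2.2.2.1, h.2.2.2.1, h.2.2.2.2.2.symm⟩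

lemma hole_apex {x : V} {f : ℕ → V} {m : ℕ} (hm : 2 ≤ m)
    (h1 : ∀ i < m, G.Adj (f i) (f (i+1))) (h2 : ∀ i j, i + 1 < j → j ≤ m → Miss G (f i) (f j))
    (h3 : G.Adj x (f 0)) (h4 : G.Adj x (f m)) (h5 : ∀ i, 0 < i → i < m → Miss G x (f i)) :
    IsHole G (m+2) (fun i => if i = 0 then x else f (i-1)) := by
  refine ⟨by omega, ?_, ?_⟩
  · intro i j hij hj
    have hj0 : j ≠ 0 := by omega
    simp only [hj0, if_false]
    by_cases hi : i = 0
    · simp only [hi, if_true]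
      rcases eq_or_ne j 1 with rfl | h
      · exact h3.ne
      rcases eq_or_ne j (m+1) with rfl | h'
      · exact h4.ne
      exact (h5 (j-1) (by omega) (by omega)).1
    · simp only [hi, if_false]
      rcases eq_or_ne j (i+1) with rfl | h
      · have := (h1 (i-1) (by omega)).ne
        have e : i - 1 + 1 = i + 1 - 1 := by omega
        rwa [e] at this
      · exact (h2 (i-1) (j-1) (by omega) (by omega)).1
  · intro i j hij hj
    have hj0 : j ≠ 0 := by omega
    simp only [hj0, if_false]
    by_cases hi : i = 0
    · simp only [hi, if_true]
      rcases eq_or_ne j 1 with rfl | h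
      · simp [h3]
      rcases eq_or_ne j (m+1) with rfl | h'
      · simp [h4]
      have := (h5 (j-1) (by omega) (by omega)).2
      simp only [this, false_iff]; omega
    · simp only [hi, if_false]
      rcases eq_or_ne j (i+1) with rfl | h
      · have := (h1 (i-1) (by omega))
        have e : i - 1 + 1 = i + 1 - 1 := by omega
        rw [e] at this
        exact ⟨fun _ => Or.inl rfl, fun _ => this⟩
      · have := (h2 (i-1) (j-1) (by omega) (by omega)).2
        refine ⟨fun h' => absurd h' this, fun h' => ?_⟩
        rcases h' with h' | h'
        · exact absurd h' h
        · exact absurd h'.1 (by simp)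

lemma noC4 (hG : NoHole G) {a b c d : V} (h1 : G.Adj a b) (h2 : G.Adj b c) (h3 : G.Adj c d)
    (h4 : G.Adj d a) (h5 : Miss G a c) (h6 : Miss G b d) : False := by
  refine hG _ _ (hole_apex (x := a) (m := 2)
    (f := fun i => if i = 0 then b else if i = 1 then c else d) le_rfl ?_ ?_ ?_ ?_ ?_)
  · intro i hi; interval_cases i <;> simpa
  · intro i j hi hj
    obtain ⟨rfl, rfl⟩ : i = 0 ∧ j = 2 := by omega
    simpa
  · simpa
  · simpa using h4.symm
  · intro i hi hi'
    obtain rfl : i = 1 := by omega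
    simpa

lemma noC5 (hG : NoHole G) {a b c d e : V} (h1 : G.Adj a b) (h2 : G.Adj b c) (h3 : G.Adj c d)
    (h4 : G.Adj d e) (h5 : G.Adj e a) (h6 : Miss G a c) (h7 : Miss G a d) (h8 : Miss G b d)
    (h9 : Miss G b e) (h10 : Miss G c e) : False := by
  refine hG _ _ (hole_apex (x := a) (m := 3)
    (f := fun i => if i = 0 then b else if i = 1 then c else if i = 2 then d else e)
    (by norm_num) ?_ ?_ ?_ ?_ ?_)
  · intro i hi; interval_cases i <;> simpa
  · intro i j hi hj
    have : (i = 0 ∧ j = 2) ∨ (i = 0 ∧ j = 3) ∨ (i = 1 ∧ j = 3) := by omega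
    rcases this with ⟨rfl, rfl⟩ | ⟨rfl, rfl⟩ | ⟨rfl, rfl⟩ <;> simpa
  · simpa
  · simpa using h5.symm
  · intro i hi hi'
    have : i = 1 ∨ i = 2 := by omega
    rcases this with rfl | rfl <;> simpa

end graph

section model
variable {V : Type} [Fintype V] {G : SimpleGraph V} {M : CAModel V}

lemma Miss.disj (hM : M.IsModelOf G) {u v : V} (h : Miss G u v) {p : Circ} (h1 : p ∈ M.P u) :
    p ∉ M.P v := fun h2 => h.2 ((hM u v).2 ⟨h.1, p, h1, h2⟩)

lemma miss_iff (hM : M.IsModelOf G) {u v : V} : Miss G u v ↔ ¬ M.Inter u v := by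
  constructor
  · rintro h ⟨p, h1, h2⟩
    exact h.disj hM h1 h2
  · intro h
    refine ⟨?_, fun h' => h ((hM u v).1 h').2⟩
    rintro rfl; exact h (M.inter_self u)

lemma adj_inter (hM : M.IsModelOf G) {u v : V} (h : G.Adj u v) : M.Inter u v := ((hM u v).1 h).2

lemma adj_of_ne (hM : M.IsModelOf G) {u v : V} (h : u ≠ v) (h2 : M.Inter u v) : G.Adj u v :=
  (hM u v).2 ⟨h, h2⟩

lemma not_miss (hM : M.IsModelOf G) {u v : V} (h : ¬ Miss G u v) : M.Inter u v := by
  rw [miss_iff hM] at h; exact not_not.1 h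

end model


section emb
variable {V W : Type} {G : SimpleGraph V}

lemma mkEmb {H : SimpleGraph W} (φ : W → V)
    (h : ∀ i j, i ≠ j → (H.Adj i j ∧ G.Adj (φ i) (φ j)) ∨ (¬ H.Adj i j ∧ Miss G (φ i) (φ j))) :
    Nonempty (H ↪g G) := by
  have inj : Function.Injective φ := by
    intro i j hij
    by_contra hne
    rcases h i j hne with h | h
    · exact h.2.ne hij
    · exact h.2.1 hij
  refine ⟨⟨⟨φ, inj⟩, ?_⟩⟩
  intro i j
  by_cases hne : i = j
  · subst hne; simp
  · rcases h i j hne with h | h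
    · simp [h]
    · simp [h, h.2.2]

lemma mkEmbLt [LinearOrder W] {H : SimpleGraph W} (φ : W → V)
    (h : ∀ i j, i < j → (H.Adj i j ∧ G.Adj (φ i) (φ j)) ∨ (¬ H.Adj i j ∧ Miss G (φ i) (φ j))) :
    Nonempty (H ↪g G) := by
  apply mkEmb φ
  intro i j hij
  rcases lt_or_gt_of_ne hij with hlt | hlt
  · exact h i j hlt
  · rcases h j i hlt with h | h
    · exact Or.inl ⟨h.1.symm, h.2.symm⟩
    · exact Or.inr ⟨fun h' => h.1 h'.symm, h.2.symm⟩

lemma use_sun3 (hS : IsEmpty (sun3 ↪g G)) {x y z a b c : V} (h1 : G.Adj x y) (h2 : G.Adj y z)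
    (h3 : G.Adj x z) (a1 : G.Adj a x) (a2 : G.Adj a y) (a3 : Miss G a z)
    (b1 : G.Adj b y) (b2 : G.Adj b z) (b3 : Miss G b x)
    (c1 : G.Adj c z) (c2 : G.Adj c x) (c3 : Miss G c y)
    (m1 : Miss G a b) (m2 : Miss G a c) (m3 : Miss G b c) : False := by
  refine hS.elim' (Classical.choice (mkEmbLt (![x, y, z, a, b, c]) ?_))
  intro i j hij
  fin_cases i <;> fin_cases j <;> first
    | (exfalso; revert hij; decide)
    | (left; refine ⟨by simp [sun3], ?_⟩; first | assumption | (apply SimpleGraph.Adj.symm; assumption))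
    | (right; refine ⟨by simp [sun3], ?_⟩; first | assumption | (apply Miss.symm; assumption))

lemma use_umbrella (hU : IsEmpty (umbrella ↪g G)) {p0 p1 p2 p3 p4 c u : V}
    (h1 : G.Adj p0 p1) (h2 : G.Adj p1 p2) (h3 : G.Adj p2 p3) (h4 : G.Adj p3 p4)
    (m1 : Miss G p0 p2) (m2 : Miss G p0 p3) (m3 : Miss G p0 p4) (m4 : Miss G p1 p3)
    (m5 : Miss G p1 p4) (m6 : Miss G p2 p4)
    (c0 : G.Adj c p0) (c1 : G.Adj c p1) (c2 : G.Adj c p2) (c3 : G.Adj c p3) (c4 : G.Adj c p4)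
    (u2 : G.Adj u p2) (u0 : Miss G u p0) (u1 : Miss G u p1) (u3 : Miss G u p3)
    (u4 : Miss G u p4) (uc : Miss G u c) : False := by
  refine hU.elim' (Classical.choice (mkEmbLt (![p0, p1, p2, p3, p4, c, u]) ?_))
  intro i j hij
  fin_cases i <;> fin_cases j <;> first
    | (exfalso; revert hij; decide)
    | (left; refine ⟨by simp [umbrella], ?_⟩; first | assumption | (apply SimpleGraph.Adj.symm; assumption))
    | (right; refine ⟨by simp [umbrella], ?_⟩; first | assumption | (apply Miss.symm; assumption))

lemma use_wheel (hW : ∀ n : ℕ, 4 ≤ n → IsEmpty (wheel n ↪g G)) {n : ℕ} {u : ℕ → V}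
    (hu : IsHole G n u) {x : V} (hx : ∀ i < n, G.Adj x (u i)) : False := by
  obtain ⟨h4, hinj, hadj⟩ := hu
  refine (hW n h4).elim' (Classical.choice (mkEmb (Sum.elim (fun i : Fin n => u i) (fun _ => x)) ?_))
  have key : ∀ i j : Fin n, i < j → ((wheel n).Adj (Sum.inl i) (Sum.inl j) ∧ G.Adj (u i) (u j)) ∨
      (¬ (wheel n).Adj (Sum.inl i) (Sum.inl j) ∧ Miss G (u i) (u j)) := by
    intro i j hij
    have hij' : (i:ℕ) < j := hij
    have e : (wheel n).Adj (Sum.inl i) (Sum.inl j) ↔ G.Adj (u i) (u j) := by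
      rw [hadj i j hij j.2]
      have hj := j.2
      have hmod : ((i:ℕ) + 1) % n = i + 1 := Nat.mod_eq_of_lt (by omega)
      have hne : i ≠ j := ne_of_lt hij
      have hmod2 : ((j:ℕ) + 1) % n = i ↔ ((i:ℕ) = 0 ∧ (j:ℕ) = n - 1) := by
        rcases Nat.lt_or_ge (j+1) n with h | h
        · rw [Nat.mod_eq_of_lt h]; omega
        · have : (j:ℕ) + 1 = n := by omega
          rw [this, Nat.mod_self]; omega
      simp only [wheel, SimpleGraph.fromRel_adj]
      constructor
      · rintro ⟨-, (⟨x, hx⟩ | ⟨i', j', h1, h2, h3⟩) | (⟨x, hx⟩ | ⟨i', j', h1, h2, h3⟩)⟩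
        · cases hx
        · cases h1; cases h2; left; omega
        · cases hx
        · cases h1; cases h2; right; exact hmod2.1 h3
      · rintro (h | h)
        · exact ⟨by simpa using hne, Or.inl (Or.inr ⟨i, j, rfl, rfl, by omega⟩)⟩
        · exact ⟨by simpa using hne, Or.inr (Or.inr ⟨j, i, rfl, rfl, hmod2.2 h⟩)⟩
    by_cases ha : G.Adj (u i) (u j)
    · exact Or.inl ⟨e.2 ha, ha⟩
    · exact Or.inr ⟨fun h => ha (e.1 h), hinj i j hij' j.2, ha⟩
  rintro (i | i) (j | j) hij
  · have hij : i ≠ j := by simpa using hij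
    rcases lt_or_gt_of_ne hij with hlt | hlt
    · exact key i j hlt
    · rcases key j i hlt with h | h
      · exact Or.inl ⟨h.1.symm, h.2.symm⟩
      · exact Or.inr ⟨fun h' => h.1 h'.symm, h.2.symm⟩
  · left; exact ⟨by simp [wheel], (hx i i.2).symm⟩
  · left; exact ⟨by simp [wheel], (hx j j.2)⟩
  · exact absurd rfl hij

/-- `x = v_1`, `f 1, …, f (m-1)` the path, `y = v_n`, `n = m+1`. -/
lemma use_rising (hR : ∀ n : ℕ, 4 ≤ n → IsEmpty (risingSun n ↪g G)) {m : ℕ} (hm : 3 ≤ m)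
    {x y u : V} {f : ℕ → V} (hxy : G.Adj x y)
    (h1 : ∀ i < m, G.Adj (f i) (f (i+1))) (h2 : ∀ i j, i + 1 < j → j ≤ m → Miss G (f i) (f j))
    (hx : ∀ i, i < m → G.Adj x (f i)) (hy : ∀ i, 0 < i → i ≤ m → G.Adj y (f i))
    (hxm : Miss G x (f m)) (hy0 : Miss G y (f 0)) (hu : ∀ i ≤ m, Miss G u (f i))
    (hux : G.Adj u x) (huy : G.Adj u y) : False := by
  obtain ⟨ψ, ψ0, ψm, ψi⟩ : ∃ ψ : ℕ → V, ψ 0 = x ∧ ψ m = y ∧ ∀ i, i ≠ 0 → i ≠ m → ψ i = f i :=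
    ⟨fun i => if i = 0 then x else if i = m then y else f i, by simp,
      by simp [show m ≠ 0 by omega], fun i h h' => by simp [h, h']⟩
  let φ : Fin (m+1) ⊕ Fin 3 → V := Sum.elim (fun i : Fin (m+1) => ψ i) (![f 0, f m, u])
  refine (hR (m+1) (by omega)).elim' (Classical.choice (mkEmb φ ?_))
  have flip : ∀ i j, ((risingSun (m+1)).Adj i j ∧ G.Adj (φ i) (φ j)) ∨
      (¬ (risingSun (m+1)).Adj i j ∧ Miss G (φ i) (φ j)) →
      ((risingSun (m+1)).Adj j i ∧ G.Adj (φ j) (φ i)) ∨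
      (¬ (risingSun (m+1)).Adj j i ∧ Miss G (φ j) (φ i)) := by
    rintro i j (h | h)
    · exact Or.inl ⟨h.1.symm, h.2.symm⟩
    · exact Or.inr ⟨fun h' => h.1 h'.symm, h.2.symm⟩
  have e0 : ∀ i j : Fin (m+1), i < j → ((risingSun (m+1)).Adj (Sum.inl i) (Sum.inl j) ↔
      ((i:ℕ) = 0 ∨ (j:ℕ) = m ∨ (j:ℕ) = i + 1)) := by
    intro i j hij
    have hij' : (i:ℕ) < j := hij
    simp only [risingSun, SimpleGraph.fromRel_adj, Nat.add_sub_cancel, ne_eq, Sum.inl.injEq,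
      Fin.lt_def, Fin.ext_iff]
    have := i.2
    have := j.2
    omega
  have e1 : ∀ (w : Fin 3) (a : Fin (m+1)), (risingSun (m+1)).Adj (Sum.inr w) (Sum.inl a) ↔
        ((w : ℕ) = 0 ∧ ((a : ℕ) = 0 ∨ (a : ℕ) = 1)) ∨
        ((w : ℕ) = 1 ∧ ((a : ℕ) = m - 1 ∨ (a : ℕ) = m)) ∨
        ((w : ℕ) = 2 ∧ ((a : ℕ) = m ∨ (a : ℕ) = 0)) := by
    intro w a
    simp [risingSun, SimpleGraph.fromRel_adj]
  have k1 : ∀ i j : Fin (m+1), i < j → _ := fun i j hij => flip (Sum.inl j) (Sum.inl i) (flip (Sum.inl i) (Sum.inl j) (by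
    have hij' : (i:ℕ) < j := hij
    have hj := j.2
    rw [e0 i j hij]
    have hj0 : (j:ℕ) ≠ 0 := by omega
    have him : (i:ℕ) ≠ m := by omega
    change (_ ∧ G.Adj (ψ i) (ψ j)) ∨ (_ ∧ Miss G (ψ i) (ψ j))
    by_cases hi : (i:ℕ) = 0
    · left
      refine ⟨Or.inl hi, ?_⟩
      rw [hi, ψ0]
      by_cases hjm : (j:ℕ) = m
      · rw [hjm, ψm]; exact hxy
      · rw [ψi _ hj0 hjm]; exact hx _ (by omega)
    · rw [ψi _ hi him]
      by_cases hjm : (j:ℕ) = m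
      · left
        refine ⟨Or.inr (Or.inl hjm), ?_⟩
        rw [hjm, ψm]; exact (hy i (by omega) (by omega)).symm
      · rw [ψi _ hj0 hjm]
        by_cases hc : (j:ℕ) = i + 1
        · left
          refine ⟨Or.inr (Or.inr hc), ?_⟩
          rw [hc]; exact h1 i (by omega)
        · right
          exact ⟨by omega, h2 i j (by omega) (by omega)⟩))
  have k2 : ∀ (w : Fin 3) (a : Fin (m+1)), _ := fun w a => flip (Sum.inl a) (Sum.inr w) (flip (Sum.inr w) (Sum.inl a) (by
    rw [e1 w a]
    have ha := a.2
    change (_ ∧ G.Adj (![f 0, f m, u] w) (ψ a)) ∨ (_ ∧ Miss G (![f 0, f m, u] w) (ψ a))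
    generalize (a : ℕ) = a at *
    by_cases ha0 : a = 0
    · have hm1 : 0 ≠ m - 1 := by omega
      have hm0 : 0 ≠ m := by omega
      subst ha0
      rw [ψ0]
      fin_cases w
      · left; exact ⟨by simp, (hx 0 (by omega)).symm⟩
      · right; exact ⟨by simp [hm1, hm0], hxm.symm⟩
      · left; exact ⟨by simp, hux⟩
    by_cases ham : a = m
    · have hm1 : m ≠ 1 := by omega
      have hm0 : m ≠ 0 := by omega
      subst ham
      rw [ψm]
      fin_cases w
      · right; exact ⟨by simp [hm1, hm0], hy0.symm⟩
      · left; exact ⟨by simp, (hy _ (by omega) le_rfl).symm⟩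
      · left; exact ⟨by simp, huy⟩
    rw [ψi _ ha0 ham]
    fin_cases w
    · by_cases hc : a = 1
      · left; subst hc; exact ⟨by simp, h1 0 (by omega)⟩
      · right; exact ⟨by simp [hc, ha0], h2 0 a (by omega) (by omega)⟩
    · by_cases hc : a = m - 1
      · have := h1 (m-1) (by omega)
        rw [Nat.sub_add_cancel (by omega)] at this
        left; exact ⟨by simp [hc], by rw [hc]; exact this.symm⟩
      · right; exact ⟨by simp [hc, ham], (h2 a m (by omega) (by omega)).symm⟩
    · right; exact ⟨by simp [ha0, ham], hu a (by omega)⟩))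
  rintro (i | i) (j | j) hij
  · have hij : i ≠ j := by simpa using hij
    rcases lt_or_gt_of_ne hij with hlt | hlt
    · exact k1 i j hlt
    · exact flip _ _ (k1 j i hlt)
  · exact flip _ _ (k2 j i)
  · exact k2 i j
  · right
    have n1 := h2 0 m (by omega) le_rfl
    have n2 := hu 0 (by omega)
    have n3 := hu m le_rfl
    fin_cases i <;> fin_cases j <;> first
      | exact absurd rfl hij
      | (refine ⟨by simp [risingSun], ?_⟩; first | assumption | (apply Miss.symm; assumption))

end emb


section hole
variable {V : Type} {G : SimpleGraph V}

lemma IsHole.rotate {n r : ℕ} {u : ℕ → V} (h : IsHole G n u) (hr : r < n) :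
    IsHole G n (fun i => u (if i + r < n then i + r else i + r - n)) := by
  obtain ⟨h4, hinj, hadj⟩ := h
  have hadj' : ∀ i j, j < i → i < n → (G.Adj (u i) (u j) ↔ i = j + 1 ∨ (j = 0 ∧ i = n - 1)) := by
    intro i j h1 h2
    rw [SimpleGraph.adj_comm]; exact hadj j i h1 h2
  refine ⟨h4, ?_, ?_⟩
  · intro i j hij hj
    simp only
    split_ifs with c1 c2
    · exact hinj _ _ (by omega) (by omega)
    · exact (hinj _ _ (by omega) (by omega)).symm
    · omega
    · exact hinj _ _ (by omega) (by omega)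
  · intro i j hij hj
    simp only
    split_ifs with c1 c2
    · rw [hadj _ _ (by omega) (by omega)]; omega
    · rw [hadj' _ _ (by omega) (by omega)]; omega
    · omega
    · rw [hadj _ _ (by omega) (by omega)]; omega

lemma IsHole.miss {n : ℕ} {u : ℕ → V} (h : IsHole G n u) {i j : ℕ} (hij : i + 1 < j) (hj : j < n)
    (h0 : i ≠ 0 ∨ j ≠ n - 1) : Miss G (u i) (u j) := by
  refine ⟨h.2.1 i j (by omega) hj, ?_⟩
  rw [h.2.2 i j (by omega) hj]; omega

lemma IsHole.adj {n : ℕ} {u : ℕ → V} (h : IsHole G n u) {i : ℕ} (hj : i + 1 < n) :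
    G.Adj (u i) (u (i+1)) := by
  rw [h.2.2 i (i+1) (by omega) hj]; omega

lemma IsHole.adj0 {n : ℕ} {u : ℕ → V} (h : IsHole G n u) :
    G.Adj (u 0) (u (n-1)) := by
  have := h.1
  rw [h.2.2 0 (n-1) (by omega) (by omega)]; omega

lemma IsHole.exists_miss (hW : ∀ n : ℕ, 4 ≤ n → IsEmpty (wheel n ↪g G)) {n : ℕ} {u : ℕ → V}
    (h : IsHole G n u) (x : V) : ∃ k < n, Miss G x (u k) := by
  have h4 := h.1
  by_contra hcon
  push Not at hcon
  by_cases hx : ∃ i < n, x = u i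
  · obtain ⟨i, hi, rfl⟩ := hx
    by_cases h2 : 2 ≤ i
    · exact hcon (i-2) (by omega) (h.miss (by omega) (by omega) (by omega)).symm
    · exact hcon (i+2) (by omega) (h.miss (by omega) (by omega) (by omega))
  · push Not at hx
    refine use_wheel hW h (x := x) ?_
    intro i hi
    by_contra hadj
    exact hcon i hi ⟨hx i hi, hadj⟩

variable [Fintype V] {M : CAModel V}

lemma inter_of_cov (hM : M.IsModelOf G) {A B x y : V} (hc : M.Cov A B) (hx : Miss G A x)
    (h : M.Inter x y) : M.Inter B y := by
  obtain ⟨p, h1, h2⟩ := h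
  rcases hc p with h3 | h3
  · exact absurd h1 (hx.disj hM h3)
  · exact ⟨p, h3, h2⟩

lemma hole_normal (hM : M.IsModelOf G) (hW : ∀ n : ℕ, 4 ≤ n → IsEmpty (wheel n ↪g G))
    {n : ℕ} {u : ℕ → V} (h : IsHole G n u) {A B : V} (hc : M.Cov A B) : False := by
  obtain ⟨r, hr, hBr⟩ := h.exists_miss hW B
  have h' := h.rotate hr
  have hu0 : u r = (fun i => u (if i + r < n then i + r else i + r - n)) 0 := by simp [hr]
  rw [hu0] at hBr
  generalize (fun i => u (if i + r < n then i + r else i + r - n)) = u' at *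
  clear h hu0 u
  rename' u' => u, h' => h
  obtain ⟨k, hk, hAk⟩ := h.exists_miss hW A
  have h4 := h.1
  have hA0 : M.Inter A (u 0) := inter_of_cov hM hc.symm hBr (M.inter_self _)
  have hA1 : M.Inter A (u 1) := inter_of_cov hM hc.symm hBr (adj_inter hM (h.adj (by omega)))
  have hAn : M.Inter A (u (n-1)) := inter_of_cov hM hc.symm hBr (adj_inter hM h.adj0)
  have nk : ∀ t, M.Inter A (u t) → t ≠ k := by
    rintro t ht rfl
    exact (miss_iff hM).1 hAk ht
  have k0 := nk 0 hA0
  have k1 := nk 1 hA1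
  have kn := nk _ hAn
  have hAne : ∀ t, 1 ≤ t → t < n → A ≠ u t := by
    rintro t h1 h2 rfl
    by_cases ht1 : t = 1
    · subst ht1
      exact (miss_iff hM).1 (h.miss (i := 1) (j := n-1) (by omega) (by omega) (by omega)) hAn
    by_cases htn : t = n - 1
    · exact (miss_iff hM).1 (h.miss (i := 1) (j := t) (by omega) (by omega) (by omega))
        (M.inter_symm hA1)
    · exact (miss_iff hM).1 (h.miss (i := 0) (j := t) (by omega) (by omega) (by omega))
        (M.inter_symm hA0)
  -- smallest i > k
  classical
  have exi : ∃ i, k < i ∧ M.Inter A (u i) := ⟨n-1, by omega, hAn⟩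
  obtain ⟨i, ⟨hki, hAi⟩, himin⟩ : ∃ i, (k < i ∧ M.Inter A (u i)) ∧
      ∀ t, k < t → t < i → ¬ M.Inter A (u t) :=
    ⟨Nat.find exi, Nat.find_spec exi, fun t h1 h2 h3 => Nat.find_min exi h2 ⟨h1, h3⟩⟩
  have hin : i ≤ n - 1 := by
    by_contra hlt
    exact himin (n-1) (by omega) (by omega) hAn
  have exj : ∃ d, d ≤ k ∧ M.Inter A (u (k - d)) := ⟨k-1, by omega, by
    rw [show k - (k-1) = 1 by omega]; exact hA1⟩
  obtain ⟨j, ⟨hjk, hAj⟩, hjmax⟩ : ∃ j, (j < k ∧ M.Inter A (u j)) ∧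
      ∀ t, j < t → t < k → ¬ M.Inter A (u t) := by
    have hs := Nat.find_spec exj
    have := nk _ hs.2
    refine ⟨k - Nat.find exj, ⟨by omega, hs.2⟩, fun t h1 h2 h3 => ?_⟩
    refine Nat.find_min exj (m := k - t) (by omega) ⟨by omega, ?_⟩
    rw [show k - (k-t) = t by omega]; exact h3
  have hj1 : 1 ≤ j := by
    by_contra hlt
    exact hjmax 1 (by omega) (by omega) hA1
  have hmid : ∀ t, j < t → t < i → Miss G A (u t) := by
    intro t h1 h2
    rcases lt_trichotomy t k with h | h | h
    · exact (miss_iff hM).2 (hjmax t h1 h)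
    · rw [h]; exact hAk
    · exact (miss_iff hM).2 (himin t h h2)
  have hhole := hole_apex (G := G) (x := A) (f := fun t => u (j + t)) (m := i - j) (by omega)
    (fun t ht => h.adj (i := j + t) (by omega))
    (fun a b hab hb => h.miss (by omega) (by omega) (by omega))
    (adj_of_ne hM (hAne _ (by omega) (by omega)) hAj)
    (adj_of_ne hM (hAne _ (by omega) (by omega)) (by
      rw [show j + (i - j) = i by omega]; exact hAi))
    (fun t h1 h2 => hmid _ (by omega) (by omega))
  have hBint : ∀ t, j ≤ t → t ≤ i → M.Inter B (u t) := by
    intro t h1 h2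
    rcases eq_or_lt_of_le h1 with rfl | h1
    · exact inter_of_cov hM hc (hmid (j+1) (by omega) (by omega))
        (M.inter_symm (adj_inter hM (h.adj (by omega))))
    rcases eq_or_lt_of_le h2 with rfl | h2
    · refine inter_of_cov hM hc (hmid (t-1) (by omega) (by omega)) (adj_inter hM ?_)
      have := h.adj (i := t-1) (by omega)
      rwa [show t - 1 + 1 = t by omega] at this
    · exact inter_of_cov hM hc (hmid t h1 h2) (M.inter_self _)
  refine use_wheel hW hhole (x := B) ?_
  intro t ht
  by_cases ht0 : t = 0
  · simp only [ht0, if_true]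
    exact adj_of_ne hM hc.ne.symm (M.inter_symm hc.inter)
  · simp only [ht0, if_false]
    refine adj_of_ne hM ?_ (hBint _ (by omega) (by omega))
    intro hB
    by_cases e1 : j + (t - 1) = j
    · rw [e1] at hB
      have := hBint i (by omega) le_rfl
      rw [hB] at this
      exact (miss_iff hM).1 (h.miss (i := j) (j := i) (by omega) (by omega) (by omega)) this
    by_cases e2 : j + (t - 1) = i
    · rw [e2] at hB
      have := hBint j le_rfl (by omega)
      rw [hB] at this
      exact (miss_iff hM).1 (h.miss (i := j) (j := i) (by omega) (by omega) (by omega))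
        (M.inter_symm this)
    · have := hmid (j + (t-1)) (by omega) (by omega)
      rw [← hB] at this
      exact (miss_iff hM).1 this hc.inter

end hole


namespace CAModel
variable {V : Type} [Fintype V] (M : CAModel V)

/-- right end of an arc not containing the base point -/
def Rr (g : Circ) (v : V) : ℝ := if M.T g v = 0 then 1 else M.T g v

variable {M}

lemma unc_lt {g : Circ} {v : V} (h : g ∉ M.P v) : M.S g v < M.Rr g v := by
  rw [base_mem'] at h
  have := M.facts g v
  unfold Rr
  grind

lemma unc_mem {g : Circ} {v : V} (h : g ∉ M.P v) (p : Circ) :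
    p ∈ M.P v ↔ M.S g v < coo g p ∧ coo g p < M.Rr g v := by
  rw [base_mem'] at h
  have := M.facts g v
  have := coo_nonneg g p
  have := coo_lt_one g p
  rw [M.mem_P g]
  unfold Rr arcR
  grind

lemma unc_inter {g : Circ} {u v : V} (hu : g ∉ M.P u) (hv : g ∉ M.P v) (h : M.Inter u v) :
    M.S g u < M.Rr g v ∧ M.S g v < M.Rr g u := by
  obtain ⟨p, h1, h2⟩ := h
  have h1 := (unc_mem hu p).1 h1
  have h2 := (unc_mem hv p).1 h2
  constructor <;> linarith

lemma Rr_le_one (g : Circ) (v : V) : M.Rr g v ≤ 1 := by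
  have := M.facts g v
  unfold Rr; split_ifs <;> linarith

lemma unc_miss {g : Circ} {u v : V} (hu : g ∉ M.P u) (hv : g ∉ M.P v) (h : ¬ M.Inter u v) :
    M.Rr g u ≤ M.S g v ∨ M.Rr g v ≤ M.S g u := by
  by_contra hcon
  push Not at hcon
  apply h
  have h1 := unc_lt hu
  have h2 := unc_lt hv
  have h3 := M.facts g u
  have h4 := M.facts g v
  have h5 := M.Rr_le_one g u
  have h6 : max (M.S g u) (M.S g v) < min (M.Rr g u) (M.Rr g v) := by
    apply max_lt <;> apply lt_min <;> linarith
  have h7 := le_max_left (M.S g u) (M.S g v)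
  have h8 := le_max_right (M.S g u) (M.S g v)
  have h9 := min_le_left (M.Rr g u) (M.Rr g v)
  have h10 := min_le_right (M.Rr g u) (M.Rr g v)
  obtain ⟨p, hp⟩ := coo_surj g
    (r := (max (M.S g u) (M.S g v) + min (M.Rr g u) (M.Rr g v)) / 2) (by linarith) (by linarith)
  refine ⟨p, (unc_mem hu p).2 ?_, (unc_mem hv p).2 ?_⟩ <;> rw [hp] <;> constructor <;> linarith

/-- staying left of `b` -/
lemma stay_left {g : Circ} {b : V} (hb : g ∉ M.P b) {R : V → V → Prop} {a c : V}
    (hR : ∀ x y, R x y → M.Inter x y ∧ g ∉ M.P x ∧ g ∉ M.P y ∧ ¬ M.Inter y b)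
    (h : ReflTransGen R a c) (ha : M.Rr g a ≤ M.S g b) : M.Rr g c ≤ M.S g b := by
  induction h with
  | refl => exact ha
  | @tail x y hx hxy ih =>
    obtain ⟨h1, h2, h3, h4⟩ := hR x y hxy
    rcases unc_miss h3 hb h4 with h5 | h5
    · exact h5
    · have := unc_inter h2 h3 h1
      have := unc_lt hb
      linarith

lemma stay_right {g : Circ} {b : V} (hb : g ∉ M.P b) {R : V → V → Prop} {a c : V}
    (hR : ∀ x y, R x y → M.Inter x y ∧ g ∉ M.P x ∧ g ∉ M.P y ∧ ¬ M.Inter y b)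
    (h : ReflTransGen R a c) (ha : M.Rr g b ≤ M.S g a) : M.Rr g b ≤ M.S g c := by
  induction h with
  | refl => exact ha
  | @tail x y hx hxy ih =>
    obtain ⟨h1, h2, h3, h4⟩ := hR x y hxy
    rcases unc_miss h3 hb h4 with h5 | h5
    · have := unc_inter h2 h3 h1
      have := unc_lt hb
      linarith
    · exact h5

end CAModel

section G12
variable {V : Type} [Fintype V] {G : SimpleGraph V} {M : CAModel V}
open CAModel

lemma at_mid (hM : M.IsModelOf G) {p : Circ} {a b c : V} (hb : p ∉ M.P b) (hc : p ∉ M.P c)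
    (h1 : M.Rr p a ≤ M.S p b) (h2 : M.Rr p b ≤ M.S p c)
    (hW : ∀ z, Miss G b z → p ∉ M.P z) (hC : Conn G b a c) : False := by
  have := stay_left (M := M) (g := p) (b := b) (a := a) (c := c) hb ?_ hC h1
  · have := unc_lt hb
    have := unc_lt hc
    linarith
  · rintro x y ⟨hxy, hx, hy⟩
    exact ⟨adj_inter hM hxy, hW _ hx, hW _ hy, (miss_iff hM).1 hy.symm⟩

lemma at_cover (hM : M.IsModelOf G) {a b c : V} (hAT : AT G a b c) (p : Circ) :
    ∃ z, (Miss G a z ∨ Miss G b z ∨ Miss G c z) ∧ p ∈ M.P z := by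
  by_contra hcon
  push Not at hcon
  obtain ⟨hab, hac, hbc, cc, cb, ca⟩ := hAT
  have ua := hcon a (Or.inr (Or.inl hab.symm))
  have ub := hcon b (Or.inl hab)
  have uc := hcon c (Or.inl hac)
  have wa : ∀ z, Miss G a z → p ∉ M.P z := fun z hz => hcon z (Or.inl hz)
  have wb : ∀ z, Miss G b z → p ∉ M.P z := fun z hz => hcon z (Or.inr (Or.inl hz))
  have wc : ∀ z, Miss G c z → p ∉ M.P z := fun z hz => hcon z (Or.inr (Or.inr hz))
  have la := unc_lt ua
  have lb := unc_lt ub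
  have lc := unc_lt uc
  rcases unc_miss ua ub ((miss_iff hM).1 hab) with h1 | h1 <;>
  rcases unc_miss ua uc ((miss_iff hM).1 hac) with h2 | h2 <;>
  rcases unc_miss ub uc ((miss_iff hM).1 hbc) with h3 | h3
  · exact at_mid hM ub uc h1 h3 wb cb
  · exact at_mid hM uc ub h2 h3 wc cc
  · linarith
  · exact at_mid hM ua ub h2 h1 wa ca.symm
  · exact at_mid hM ua uc h1 h2 wa ca
  · linarith
  · exact at_mid hM uc ua h3 h2 wc cc.symm
  · exact at_mid hM ub ua h3 h1 wb cb.symm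

lemma cov_or_sub {A v : V} (h1 : M.pt A ∈ M.P v) (h2 : M.ps A ∈ M.P v) :
    M.Cov A v ∨ M.P A ⊆ M.P v := by
  obtain ⟨g, hg, -⟩ := M.inter_self A
  have hg : g ∈ M.P A := hg
  rw [base_mem'] at hg
  have hne : A ≠ v := by
    rintro rfl; exact M.pt_notMem _ h1
  have f1 := M.facts g A
  have f2 := M.facts g v
  have f3 := M.facts2 g hne
  rw [M.mem_P g, coo_pt, arcR] at h1
  rw [M.mem_P g, coo_ps, arcR] at h2
  by_cases hc : M.T g A < M.T g v ∧ M.T g v < M.S g v ∧ M.S g v < M.S g A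
  · right
    intro p
    rw [M.mem_P g, M.mem_P g, arcR, arcR]
    grind
  · left
    intro p
    rw [M.mem_P g, M.mem_P g, arcR, arcR]
    grind

lemma inside_disj {A v : V} {p : Circ} (h1 : M.pt A ∉ M.P v) (h2 : M.ps A ∉ M.P v)
    (hp : p ∉ M.P A) (hp' : p ∈ M.P v) : ¬ M.Inter A v := by
  rintro ⟨q, hq, hq'⟩
  have hq : q ∈ M.P A := hq
  have hq' : q ∈ M.P v := hq'
  rw [M.mem_P q] at h1 h2 hp hp' 
  rw [base_mem'] at hq hq'
  rw [coo_pt] at h1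
  rw [coo_ps] at h2
  unfold arcR at *
  grind

lemma cov_of_helly {A u v : V} {g p : Circ} (gA : g ∈ M.P A) (gu : g ∈ M.P u) (gv : g ∈ M.P v)
    (h1 : M.pt A ∈ M.P u) (h2 : M.ps A ∉ M.P u) (h3 : M.ps A ∈ M.P v) (h4 : M.pt A ∉ M.P v)
    (hp : p ∉ M.P A) (hu : p ∈ M.P u) (hv : p ∈ M.P v) : M.Cov u v := by
  rw [base_mem'] at gA gu gv
  rw [M.mem_P g] at h1 h2 h3 h4 hp hu hv
  rw [coo_ps] at h2 h3
  rw [coo_pt] at h1 h4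
  intro q
  rw [M.mem_P g, M.mem_P g]
  have := coo_nonneg g q
  have := coo_lt_one g q
  unfold arcR at *
  grind

lemma reach_aux {A u w : V} {g p : Circ} (hg : g ∈ M.P A) (hp : p ∉ M.P A) (hpu : p ∈ M.P u)
    (hsu : M.ps A ∉ M.P u) (hw : M.pt u ∈ M.P w) (hsw : M.ps A ∉ M.P w)  :
    (∃ q, q ∉ M.P A ∧ q ∈ M.P u ∧ q ∈ M.P w) ∧ M.T g u < M.T g w := by
  have hne : A ≠ u := by
    rintro rfl; exact hp hpu
  have f0 := M.facts g A
  have f1 := M.facts g u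
  have f2 := M.facts g w
  have f3 := M.facts2 g hne
  have p0 := coo_nonneg g p
  have p1 := coo_lt_one g p
  rw [base_mem'] at hg
  rw [M.mem_P g] at hp hpu hsu hw hsw
  rw [coo_ps] at hsu hsw
  rw [coo_pt] at hw
  unfold arcR at hp hpu hsu hw hsw
  have k1 : coo g p < M.T g u ∧ M.T g u < M.S g A ∧ M.T g A ≤ coo g p := by grind
  constructor
  · obtain ⟨x, hx1, hx2, hx3⟩ : ∃ x, coo g p < x ∧ x < M.T g u ∧ (M.S g w < M.T g u → M.S g w < x) := by
      by_cases h : M.S g w < M.T g u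
      · have := max_lt k1.1 h
        have h7 := le_max_left (coo g p) (M.S g w)
        have h8 := le_max_right (coo g p) (M.S g w)
        exact ⟨(max (coo g p) (M.S g w) + M.T g u)/2, by linarith, by linarith, fun _ => by linarith⟩
      · exact ⟨(coo g p + M.T g u)/2, by linarith, by linarith, fun h' => absurd h' h⟩
    obtain ⟨q, hq⟩ := coo_surj g (r := x) (by linarith) (by linarith)
    refine ⟨q, ?_, ?_, ?_⟩ <;> rw [M.mem_P g, hq] <;> unfold arcR <;> grind
  · grind

lemma two_cover (hM : M.IsModelOf G) (hH : M.Helly) (hN : NoHole G) (W : V → Prop)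
    (hW : ∀ p, ∃ z, W z ∧ p ∈ M.P z) : ∃ A B, W A ∧ W B ∧ M.Cov A B := by
  by_contra hcon
  push Not at hcon
  obtain ⟨A, hA, hmax⟩ := Set.Finite.exists_maximalFor M.P {z | W z} (Set.toFinite _)
    (by obtain ⟨z, hz, -⟩ := hW 0; exact ⟨z, hz⟩)
  have hA : W A := hA
  have hmax' : ∀ z, W z → ¬ (M.P A ⊆ M.P z ∧ M.pt A ∈ M.P z) := by
    rintro z hz ⟨h1, h2⟩
    exact M.pt_notMem A (hmax hz h1 h2)
  obtain ⟨g, hg, -⟩ := M.inter_self A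
  have hg : g ∈ M.P A := hg
  let R : V → V → Prop := fun u v => W u ∧ W v ∧ ∃ p, p ∉ M.P A ∧ p ∈ M.P u ∧ p ∈ M.P v
  have hex : ∃ x y, (W x ∧ M.pt A ∈ M.P x) ∧ (W y ∧ M.ps A ∈ M.P y) ∧ ReflTransGen R x y := by
    obtain ⟨u0, hu0, hu0'⟩ := hW (M.pt A)
    by_contra hno
    have hno' : ∀ y, ReflTransGen R u0 y → W y → M.ps A ∉ M.P y :=
      fun y h1 h2 h3 => hno ⟨u0, y, ⟨hu0, hu0'⟩, ⟨h2, h3⟩, h1⟩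
    have hreach : ∀ y, ReflTransGen R u0 y → W y ∧ ∃ p, p ∉ M.P A ∧ p ∈ M.P y := by
      intro y hy
      induction hy with
      | refl => exact ⟨hu0, M.pt A, M.pt_notMem A, hu0'⟩
      | tail _ h _ =>
        obtain ⟨h1, h2, p, h3, h4, h5⟩ := h
        exact ⟨h2, p, h3, h5⟩
    obtain ⟨u, hu, hum⟩ := Set.Finite.exists_maximalFor (M.T g) {z | ReflTransGen R u0 z}
      (Set.toFinite _) ⟨u0, .refl⟩
    obtain ⟨hWu, p, hpA, hpu⟩ := hreach u hu
    obtain ⟨w, hWw, hw⟩ := hW (M.pt u)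
    by_cases hsw : M.ps A ∈ M.P w
    · -- w is reachable as well
      have hsu := hno' u hu hWu
      have hne : A ≠ u := by
        rintro rfl; exact hpA hpu
      have : ∃ q, q ∉ M.P A ∧ q ∈ M.P u ∧ q ∈ M.P w := by
        have f0 := M.facts g A
        have f1 := M.facts g u
        have f2 := M.facts g w
        have f3 := M.facts2 g hne
        have p0 := coo_nonneg g p
        have p1 := coo_lt_one g p
        have hg' := hg
        rw [base_mem'] at hg'
        rw [M.mem_P g] at hpA hpu hsu hw hsw
        rw [coo_ps] at hsu hsw
        rw [coo_pt] at hw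
        unfold arcR at hpA hpu hsu hw hsw
        have k1 : coo g p < M.T g u ∧ M.T g u < M.S g A ∧ M.T g A ≤ coo g p := by grind
        obtain ⟨x, hx1, hx2, hx3⟩ : ∃ x, coo g p < x ∧ x < M.T g u ∧
            (M.S g w < M.T g u → M.S g w < x) := by
          by_cases h : M.S g w < M.T g u
          · have := max_lt k1.1 h
            have h7 := le_max_left (coo g p) (M.S g w)
            have h8 := le_max_right (coo g p) (M.S g w)
            exact ⟨(max (coo g p) (M.S g w) + M.T g u)/2, by linarith, by linarith,
              fun _ => by linarith⟩
          · exact ⟨(coo g p + M.T g u)/2, by linarith, by linarith, fun h' => absurd h' h⟩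
        obtain ⟨q, hq⟩ := coo_surj g (r := x) (by linarith) (by linarith)
        refine ⟨q, ?_, ?_, ?_⟩ <;> rw [M.mem_P g, hq] <;> unfold arcR <;> grind
      exact hno' w (ReflTransGen.tail hu ⟨hWu, hWw, this⟩) hWw hsw
    · obtain ⟨hq, hlt⟩ := reach_aux hg hpA hpu (hno' u hu hWu) hw hsw
      have hwr : ReflTransGen R u0 w := ReflTransGen.tail hu ⟨hWu, hWw, hq⟩
      have := hum hwr hlt.le
      linarith
  obtain ⟨m, f, ⟨hW0, ht0⟩, ⟨hWm, hsm⟩, hR, hshort, hnt, hns, hinj⟩ := exists_shortest R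
    (fun x => W x ∧ M.pt A ∈ M.P x) (fun x => W x ∧ M.ps A ∈ M.P x) hex
  have hWi : ∀ i ≤ m, W (f i) := by
    intro i hi
    rcases eq_or_lt_of_le hi with rfl | hi
    · exact hWm
    · exact (hR i hi).1
  have hnt : ∀ i, 0 < i → i ≤ m → M.pt A ∉ M.P (f i) := fun i h1 h2 h3 => hnt i h1 h2 ⟨hWi i h2, h3⟩
  have hns : ∀ i, i < m → M.ps A ∉ M.P (f i) := fun i h1 h3 => hns i h1 ⟨hWi i h1.le, h3⟩
  rcases Nat.eq_zero_or_pos m with rfl | hm0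
  · rcases cov_or_sub ht0 hsm with h | h
    · exact hcon _ _ hA hW0 h
    · exact hmax' _ hW0 ⟨h, ht0⟩
  rcases Nat.lt_or_ge m 2 with hm | hm
  · obtain rfl : m = 1 := by omega
    obtain ⟨_, _, p, hp, hp0, hp1⟩ := hR 0 (by omega)
    have i1 : M.Inter A (f 0) := M.inter_of_pt ht0
    have i2 : M.Inter A (f 1) := M.inter_of_ps hsm
    have i3 : M.Inter (f 0) (f 1) := ⟨p, hp0, hp1⟩
    obtain ⟨q, hq⟩ := hH {A, f 0, f 1} (by
      simp only [Set.mem_insert_iff, Set.mem_singleton_iff]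
      rintro x (rfl | rfl | rfl) y (rfl | rfl | rfl) <;> first
        | exact M.inter_self _ | assumption | (apply M.inter_symm; assumption))
    refine hcon _ _ hW0 hWm (cov_of_helly (A := A) (g := q) (hq A (by simp)) (hq _ (by simp))
      (hq _ (by simp)) ht0 (hns 0 (by omega)) hsm (hnt 1 (by omega) le_rfl) hp hp0 hp1)
  have hdisj : ∀ i, 0 < i → i < m → ¬ M.Inter A (f i) := by
    intro i h1 h2
    obtain ⟨_, _, p, hp, hp0, _⟩ := hR i h2
    exact inside_disj (hnt i h1 h2.le) (hns i h2) hp hp0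
  have hadj : ∀ i < m, G.Adj (f i) (f (i+1)) := by
    intro i hi
    obtain ⟨_, _, p, hp, hp0, hp1⟩ := hR i hi
    exact adj_of_ne hM (hinj i (i+1) (by omega) hi) ⟨p, hp0, hp1⟩
  have hmiss : ∀ i j, i + 1 < j → j ≤ m → (i ≠ 0 ∨ j ≠ m) → Miss G (f i) (f j) := by
    intro i j hij hj hh
    rw [miss_iff hM]
    rintro ⟨p, hpi, hpj⟩
    by_cases hpA : p ∈ M.P A
    · rcases hh with hh | hh
      · exact hdisj i (by omega) (by omega) ⟨p, hpA, hpi⟩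
      · exact hdisj j (by omega) (by omega) ⟨p, hpA, hpj⟩
    · exact hshort i j hij hj ⟨hWi i (by omega), hWi j hj, p, hpA, hpi, hpj⟩
  by_cases h0m : Miss G (f 0) (f m)
  · refine hN _ _ (hole_apex (x := A) (f := f) (m := m) hm hadj ?_ ?_ ?_ ?_)
    · intro i j hij hj
      by_cases hh : i ≠ 0 ∨ j ≠ m
      · exact hmiss i j hij hj hh
      · push Not at hh
        rw [hh.1, hh.2]; exact h0m
    · refine adj_of_ne hM ?_ (M.inter_of_pt ht0)
      intro h; rw [← h] at ht0; exact M.pt_notMem _ ht0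
    · refine adj_of_ne hM ?_ (M.inter_of_ps hsm)
      intro h; rw [← h] at hsm; exact M.ps_notMem _ hsm
    · intro i h1 h2
      rw [miss_iff hM]; exact hdisj i h1 h2
  · have hmid := not_miss hM h0m
    rcases Nat.lt_or_ge m 3 with hm3 | hm3
    · obtain rfl : m = 2 := by omega
      have i1 := adj_inter hM (hadj 0 (by omega))
      have i2 := adj_inter hM (hadj 1 (by omega))
      obtain ⟨q, hq⟩ := hH {f 0, f 1, f 2} (by
        simp only [Set.mem_insert_iff, Set.mem_singleton_iff]
        rintro x (rfl | rfl | rfl) y (rfl | rfl | rfl) <;> first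
          | exact M.inter_self _ | assumption | (apply M.inter_symm; assumption))
      refine hshort 0 2 (by omega) le_rfl ⟨hW0, hWm, q, ?_, hq _ (by simp), hq _ (by simp)⟩
      intro hqA
      exact hdisj 1 (by omega) (by omega) ⟨q, hqA, hq _ (by simp)⟩
    · refine hN _ _ (hole_apex (x := f 0) (f := fun t => f (t+1)) (m := m-1) (by omega)
        (fun i hi => hadj (i+1) (by omega)) ?_ (hadj 0 (by omega)) ?_ ?_)
      · intro i j hij hj
        exact hmiss _ _ (by omega) (by omega) (by omega)
      · simp only [Nat.sub_add_cancel (show 1 ≤ m by omega)]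
        exact adj_of_ne hM (hinj 0 m (by omega) le_rfl) hmid
      · intro i h1 h2
        exact hmiss 0 (i+1) (by omega) (by omega) (by omega)

end G12


section noAT
variable {V : Type} [Fintype V] {G : SimpleGraph V} {M : CAModel V}
open CAModel

lemma inter_ne (hM : M.IsModelOf G) {x y z : V} (h1 : M.Inter x z) (h2 : Miss G y z) : x ≠ y := by
  rintro rfl; exact (miss_iff hM).1 h2 h1

lemma caseI (hM : M.IsModelOf G) (hS : IsEmpty (sun3 ↪g G))
    (hR : ∀ n : ℕ, 4 ≤ n → IsEmpty (risingSun n ↪g G)) {X Y u v w : V} (hc : M.Cov X Y)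
    (hXw : Miss G X w) (hYv : Miss G Y v) (hXu : G.Adj X u) (hYu : G.Adj Y u)
    (hC : Conn G u v w) : False := by
  obtain ⟨m, f, h0, hm, hR', hshort, hn0, hnm, hinj⟩ := exists_shortest
    (fun x y => G.Adj x y ∧ Miss G u x ∧ Miss G u y) (fun z => Miss G Y z) (fun z => Miss G X z)
    ⟨v, w, hYv, hXw, hC⟩
  have hX0 : M.Inter X (f 0) := inter_of_cov hM hc.symm h0 (M.inter_self _)
  have hm0 : m ≠ 0 := by
    rintro rfl
    exact (miss_iff hM).1 hm hX0
  have hm1 : m ≠ 1 := by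
    rintro rfl
    have := adj_inter hM (hR' 0 (by omega)).1
    exact (miss_iff hM).1 hm (inter_of_cov hM hc.symm h0 this)
  have hu : ∀ i ≤ m, Miss G u (f i) := by
    intro i hi
    rcases eq_or_lt_of_le hi with rfl | hi
    · have := (hR' (i-1) (by omega)).2.2
      rwa [show i - 1 + 1 = i by omega] at this
    · exact (hR' i hi).2.1
  have hneX : ∀ i ≤ m, X ≠ f i := by
    rintro i hi rfl
    exact (hu i hi).2 hXu.symm
  have hneY : ∀ i ≤ m, Y ≠ f i := by
    rintro i hi rfl
    exact (hu i hi).2 hYu.symm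
  have hX : ∀ i < m, G.Adj X (f i) := fun i hi =>
    adj_of_ne hM (hneX i hi.le) (not_miss hM (hnm i hi))
  have hY : ∀ i, 0 < i → i ≤ m → G.Adj Y (f i) := fun i h1 hi =>
    adj_of_ne hM (hneY i hi) (not_miss hM (hn0 i h1 hi))
  have hmiss : ∀ i j, i + 1 < j → j ≤ m → Miss G (f i) (f j) := by
    intro i j hij hj
    exact ⟨hinj i j (by omega) hj, fun h => hshort i j hij hj ⟨h, hu i (by omega), hu j hj⟩⟩
  have hXY : G.Adj X Y := adj_of_ne hM hc.ne hc.inter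
  by_cases hm2 : m = 2
  · subst hm2
    exact use_sun3 hS (x := X) (y := Y) (z := f 1) (a := u) (b := f 2) (c := f 0) hXY
      (hY 1 (by omega) (by omega)) (hX 1 (by omega)) hXu.symm hYu.symm (hu 1 (by omega))
      (hY 2 (by omega) le_rfl).symm (hR' 1 (by omega)).1.symm hm.symm
      (hR' 0 (by omega)).1 (hX 0 (by omega)).symm h0.symm (hu 2 le_rfl) (hu 0 (by omega))
      (hmiss 0 2 (by omega) le_rfl).symm
  · exact use_rising hR (m := m) (by omega) (x := X) (y := Y) (u := u) (f := f) hXY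
      (fun i hi => (hR' i hi).1) hmiss hX hY hm h0 hu hXu.symm hYu.symm

lemma crossL {B p : V} {g x y : Circ} (hg : g ∈ M.P B) (h1 : M.pt B ∈ M.P p) (h2 : M.ps B ∉ M.P p)
    (hx : x ∈ M.P p) (hxB : x ∉ M.P B) (hy : y ∉ M.P p) (hyB : y ∉ M.P B) :
    coo g x < coo g y := by
  rw [base_mem'] at hg
  rw [M.mem_P g] at h1 h2 hx hxB hy hyB
  rw [coo_ps] at h2
  rw [coo_pt] at h1
  unfold arcR at *
  grind

lemma crossR {B p : V} {g x y : Circ} (hg : g ∈ M.P B) (h1 : M.ps B ∈ M.P p) (h2 : M.pt B ∉ M.P p)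
    (hx : x ∈ M.P p) (hxB : x ∉ M.P B) (hy : y ∉ M.P p) (hyB : y ∉ M.P B) :
    coo g y < coo g x := by
  rw [base_mem'] at hg
  rw [M.mem_P g] at h1 h2 hx hxB hy hyB
  rw [coo_ps] at h1
  rw [coo_pt] at h2
  unfold arcR at *
  grind

lemma orient (hM : M.IsModelOf G) {a b a' b' B p q : V} {g : Circ} (hg : g ∈ M.P B)
    (hBa : Miss G B a) (hBb : Miss G B b) (hBa' : Miss G B a') (hBb' : Miss G B b')
    (hBp : M.Inter B p) (hBq : M.Inter B q) (hpa : M.Inter p a') (hqb : M.Inter q b')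
    (hpb : Miss G p b) (hqa : Miss G q a)
    (np : ¬ (M.ps B ∈ M.P p ∧ M.pt B ∈ M.P p)) (nq : ¬ (M.ps B ∈ M.P q ∧ M.pt B ∈ M.P q))
    (d1 : ∀ x ∈ M.P a', ∀ y ∈ M.P b, coo g x < coo g y)
    (d2 : ∀ x ∈ M.P a, ∀ y ∈ M.P b', coo g x < coo g y) :
    ((M.pt B ∈ M.P p ∧ M.ps B ∉ M.P p) ∧ (M.ps B ∈ M.P q ∧ M.pt B ∉ M.P q)) ∧
    (Miss G p a → ¬ M.Inter p b' ∧ ∀ x ∉ M.P B, ¬ (x ∈ M.P p ∧ x ∈ M.P q)) ∧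
    (Miss G q b → ¬ M.Inter q a' ∧ ∀ x ∉ M.P B, ¬ (x ∈ M.P p ∧ x ∈ M.P q)) := by
  obtain ⟨ya, hya, -⟩ := M.inter_self a
  obtain ⟨yb, hyb, -⟩ := M.inter_self b
  obtain ⟨xp, hxp, hxa⟩ := hpa
  obtain ⟨xq, hxq, hxb⟩ := hqb
  have nB : ∀ z, Miss G B z → ∀ x ∈ M.P z, x ∉ M.P B := fun z hz x hx => hz.symm.disj hM hx
  have hp : M.pt B ∈ M.P p ∧ M.ps B ∉ M.P p := by
    have hs : M.ps B ∉ M.P p := by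
      intro hs
      have h1 := crossR hg hs (fun h => np ⟨hs, h⟩) hxp (nB a' hBa' xp hxa)
        (hpb.symm.disj hM hyb) (nB b hBb yb hyb)
      have h2 := d1 xp hxa yb hyb
      linarith
    refine ⟨?_, hs⟩
    by_contra ht
    exact inside_disj ht hs (nB a' hBa' xp hxa) hxp hBp
  have hq : M.ps B ∈ M.P q ∧ M.pt B ∉ M.P q := by
    have ht : M.pt B ∉ M.P q := by
      intro ht
      have h1 := crossL hg ht (fun h => nq ⟨h, ht⟩) hxq (nB b' hBb' xq hxb)
        (hqa.symm.disj hM hya) (nB a hBa ya hya)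
      have h2 := d2 ya hya xq hxb
      linarith
    refine ⟨?_, ht⟩
    by_contra hs
    exact inside_disj ht hs (nB b' hBb' xq hxb) hxq hBq
  refine ⟨⟨hp, hq⟩, ?_, ?_⟩
  · intro hpa
    constructor
    · rintro ⟨x, hx, hx'⟩
      have h1 := crossL hg hp.1 hp.2 hx (nB b' hBb' x hx') (hpa.symm.disj hM hya) (nB a hBa ya hya)
      have h2 := d2 ya hya x hx'
      linarith
    · rintro x hxB ⟨h1, h2⟩
      have h3 := crossL hg hp.1 hp.2 h1 hxB (hpa.symm.disj hM hya) (nB a hBa ya hya)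
      have h4 := crossR hg hq.1 hq.2 h2 hxB (hqa.symm.disj hM hya) (nB a hBa ya hya)
      linarith
  · intro hqb
    constructor
    · rintro ⟨x, hx, hx'⟩
      have h1 := crossR hg hq.1 hq.2 hx (nB a' hBa' x hx') (hqb.symm.disj hM hyb) (nB b hBb yb hyb)
      have h2 := d1 x hx' yb hyb
      linarith
    · rintro x hxB ⟨h1, h2⟩
      have h3 := crossL hg hp.1 hp.2 h1 hxB (hpb.symm.disj hM hyb) (nB b hBb yb hyb)
      have h4 := crossR hg hq.1 hq.2 h2 hxB (hqb.symm.disj hM hyb) (nB b hBb yb hyb)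
      linarith

lemma dist_of_le {g : Circ} {u v : V} (hu : g ∉ M.P u) (hv : g ∉ M.P v)
    (h : M.Rr g u ≤ M.S g v) : ∀ x ∈ M.P u, ∀ y ∈ M.P v, coo g x < coo g y := by
  intro x hx y hy
  have h1 := (unc_mem hu x).1 hx
  have h2 := (unc_mem hv y).1 hy
  linarith

lemma f2 {A B p q : V} {g : Circ} (gA : g ∈ M.P A) (gB : g ∈ M.P B) (gp : g ∈ M.P p)
    (gq : g ∈ M.P q) (hc : M.Cov A B) (h1 : M.pt B ∈ M.P p) (h2 : M.ps B ∉ M.P p)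
    (h3 : M.ps B ∈ M.P q) (h4 : M.pt B ∉ M.P q) : M.Cov A p ∨ M.Cov A q := by
  have c1 := hc (M.ps B)
  have c2 := hc (M.pt B)
  have c3 := hc (M.ps A)
  have c4 := hc (M.pt A)
  rw [base_mem'] at gA gB gp gq
  rw [M.mem_P g] at h1 h2 h3 h4
  rw [M.mem_P g, M.mem_P g] at c1 c2 c3 c4
  rw [coo_ps] at h2 h3 c1 c3
  rw [coo_pt] at h1 h4 c2 c4
  unfold arcR at h1 h2 h3 h4 c1 c2 c3 c4
  by_cases hh : M.S g A < M.T g B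
  · left
    intro x
    rw [M.mem_P g, M.mem_P g]
    unfold arcR
    grind
  · right
    intro x
    rw [M.mem_P g, M.mem_P g]
    unfold arcR
    grind

lemma nonwrap (hM : M.IsModelOf G) (hS : IsEmpty (sun3 ↪g G))
    (hR : ∀ n : ℕ, 4 ≤ n → IsEmpty (risingSun n ↪g G)) {A B a b c p : V} (hc : M.Cov A B)
    (hmax : ∀ z, M.Cov A z → Miss G z a → Miss G z b → ¬ (M.P B ⊆ M.P z ∧ M.pt B ∈ M.P z))
    (hAc : Miss G A c) (hAa : G.Adj A a) (hBa : Miss G B a) (hBb : Miss G B b)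
    (hpb : Miss G p b) (hBp : M.Inter B p) (hC : Conn G a b c) :
    ¬ (M.ps B ∈ M.P p ∧ M.pt B ∈ M.P p) := by
  rintro ⟨h1, h2⟩
  rcases cov_or_sub h2 h1 with h | h
  · obtain ⟨y, hy, -⟩ := M.inter_self b
    rcases h y with h3 | h3
    · exact hBb.disj hM h3 hy
    · exact hpb.disj hM h3 hy
  · have hcp : M.Cov A p := by
      intro x
      rcases hc x with h3 | h3
      · exact Or.inl h3
      · exact Or.inr (h h3)
    by_cases hpa : Miss G p a
    · exact hmax p hcp hpa hpb ⟨h, h2⟩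
    · have := not_miss hM hpa
      have hne : p ≠ a := by
        rintro rfl; exact (miss_iff hM).1 hBa hBp
      exact caseI hM hS hR hcp hAc hpb hAa (adj_of_ne hM hne this) hC

lemma final (hM : M.IsModelOf G) (hH : M.Helly) (hN : NoHole G) (hS : IsEmpty (sun3 ↪g G))
    (hR : ∀ n : ℕ, 4 ≤ n → IsEmpty (risingSun n ↪g G)) {A B a b c a' b' p q : V}
    (hcp : M.Cov A p) (hAc : Miss G A c) (hAa : G.Adj A a) (hAa' : G.Adj A a')
    (hBa : Miss G B a) (hBa' : Miss G B a') (hBb' : Miss G B b') (hBc : G.Adj B c)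
    (hBp : G.Adj B p) (hBq : G.Adj B q) (hpq : G.Adj p q) (hpa' : G.Adj p a') (hqb' : G.Adj q b')
    (hpb : Miss G p b) (ha'c : Miss G a' c) (hC : Conn G a b c)
    (h3 : Miss G p a → ¬ M.Inter p b' ∧ ∀ x ∉ M.P B, ¬ (x ∈ M.P p ∧ x ∈ M.P q)) : False := by
  by_cases hpa : Miss G p a
  · obtain ⟨hpb', hx⟩ := h3 hpa
    rw [← miss_iff hM] at hpb'
    have ha'q : Miss G a' q := by
      rw [miss_iff hM]
      intro hi
      have i1 := adj_inter hM hpq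
      have i2 := adj_inter hM hpa'
      obtain ⟨x, hx'⟩ := hH {p, a', q} (by
        simp only [Set.mem_insert_iff, Set.mem_singleton_iff]
        rintro x (rfl | rfl | rfl) y (rfl | rfl | rfl) <;> first
          | exact M.inter_self _ | assumption | (apply M.inter_symm; assumption))
      exact hx x (hBa'.symm.disj hM (hx' a' (by simp))) ⟨hx' p (by simp), hx' q (by simp)⟩
    have hmab : Miss G a' b' := by
      refine ⟨?_, fun h => noC4 hN hpa' h hqb'.symm hpq.symm hpb' ha'q⟩
      rintro rfl; exact hpb'.2 hpa'
    refine caseI hM hS hR hcp hAc hpb' hAa' hpa' ?_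
    exact ((ReflTransGen.single ⟨hqb'.symm, hmab, ha'q⟩).tail ⟨hBq.symm, ha'q, hBa'.symm⟩).tail
      ⟨hBc, hBa'.symm, ha'c⟩
  · have := not_miss hM hpa
    have hne : p ≠ a := by
      rintro rfl; exact hBa.2 hBp
    exact caseI hM hS hR hcp hAc hpb hAa (adj_of_ne hM hne this) hC

lemma finish (hM : M.IsModelOf G) (hH : M.Helly) (hN : NoHole G) (hS : IsEmpty (sun3 ↪g G))
    (hR : ∀ n : ℕ, 4 ≤ n → IsEmpty (risingSun n ↪g G)) (hU : IsEmpty (umbrella ↪g G))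
    {A B a b c a' b' p q : V}
    (hc : M.Cov A B) (hAc : Miss G A c) (hAa : G.Adj A a) (hAa' : G.Adj A a') (hAb : G.Adj A b)
    (hAb' : G.Adj A b') (hAp : G.Adj A p) (hAq : G.Adj A q)
    (hBa : Miss G B a) (hBb : Miss G B b) (hBa' : Miss G B a') (hBb' : Miss G B b')
    (hBc : G.Adj B c)
    (hBp : G.Adj B p) (hBq : G.Adj B q) (hpa' : G.Adj p a') (hqb' : G.Adj q b')
    (hpb : Miss G p b) (hqa : Miss G q a) (ha'c : Miss G a' c) (hb'c : Miss G b' c)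
    (hC : Conn G a b c) (hC' : Conn G b a c)
    (h : ((M.pt B ∈ M.P p ∧ M.ps B ∉ M.P p) ∧ (M.ps B ∈ M.P q ∧ M.pt B ∉ M.P q)) ∧
    (Miss G p a → ¬ M.Inter p b' ∧ ∀ x ∉ M.P B, ¬ (x ∈ M.P p ∧ x ∈ M.P q)) ∧
    (Miss G q b → ¬ M.Inter q a' ∧ ∀ x ∉ M.P B, ¬ (x ∈ M.P p ∧ x ∈ M.P q))) : False := by
  have hAB : G.Adj A B := adj_of_ne hM hc.ne hc.inter
  obtain ⟨⟨⟨h1, h2⟩, h3, h4⟩, h5, h6⟩ := h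
  have hne : p ≠ q := by
    rintro rfl; exact h2 h3
  by_cases hpq : G.Adj p q
  · have i1 := adj_inter hM hAB
    have i2 := adj_inter hM hAp
    have i3 := adj_inter hM hAq
    have i4 := adj_inter hM hBp
    have i5 := adj_inter hM hBq
    have i6 := adj_inter hM hpq
    obtain ⟨g, hg⟩ := hH {A, B, p, q} (by
      simp only [Set.mem_insert_iff, Set.mem_singleton_iff]
      rintro x (rfl | rfl | rfl | rfl) y (rfl | rfl | rfl | rfl) <;> first
        | exact M.inter_self _ | assumption | (apply M.inter_symm; assumption))
    rcases f2 (hg A (by simp)) (hg B (by simp)) (hg p (by simp)) (hg q (by simp)) hc h1 h2 h3 h4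
      with hcp | hcq
    · exact final hM hH hN hS hR hcp hAc hAa hAa' hBa hBa' hBb' hBc hBp hBq hpq hpa' hqb' hpb ha'c
        hC h5
    · refine final hM hH hN hS hR hcq hAc hAb hAb' hBb hBb' hBa' hBc hBq hBp hpq.symm hqb' hpa'
        hqa hb'c hC' ?_
      intro hqb
      exact ⟨(h6 hqb).1, fun x hx hx' => (h6 hqb).2 x hx hx'.symm⟩
  · have mpq : Miss G p q := ⟨hne, hpq⟩
    have mpb' : Miss G p b' := by
      refine ⟨?_, fun h => noC4 hN h hqb'.symm hBq.symm hBp mpq hBb'.symm⟩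
      rintro rfl; exact hBb'.2 hBp
    have mqa' : Miss G q a' := by
      refine ⟨?_, fun h => noC4 hN h hpa'.symm hBp.symm hBq mpq.symm hBa'.symm⟩
      rintro rfl; exact hBa'.2 hBq
    have mab : Miss G a' b' := by
      refine ⟨?_, fun h => noC5 hN hpa' h hqb'.symm hBq.symm hBp mpb' mpq mqa'.symm hBa'.symm
        hBb'.symm⟩
      rintro rfl; exact mpb'.2 hpa'
    have cp : c ≠ p := by
      rintro rfl; exact hAc.2 hAp
    have cq : c ≠ q := by
      rintro rfl; exact hAc.2 hAq
    by_cases hcp : G.Adj c p <;> by_cases hcq : G.Adj c q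
    · exact noC4 hN hcp.symm hcq hAq.symm hAp mpq hAc.symm
    · exact use_sun3 hS (x := p) (y := A) (z := B) (a := a') (b := q) (c := c) hAp.symm hAB hBp.symm
        hpa'.symm hAa'.symm hBa'.symm hAq.symm hBq.symm mpq.symm hBc.symm hcp hAc.symm mqa'.symm
        ha'c ⟨cq.symm, fun h => hcq h.symm⟩
    · exact use_sun3 hS (x := q) (y := A) (z := B) (a := b') (b := p) (c := c) hAq.symm hAB hBq.symm
        hqb'.symm hAb'.symm hBb'.symm hAp.symm hBp.symm mpq hBc.symm hcq hAc.symm mpb'.symm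
        hb'c ⟨cp.symm, fun h => hcp h.symm⟩
    · exact use_umbrella hU (p0 := a') (p1 := p) (p2 := B) (p3 := q) (p4 := b') (c := A) (u := c)
        hpa'.symm hBp.symm hBq hqb' hBa'.symm mqa'.symm mab mpq mpb' hBb' hAa' hAp hAB hAq hAb'
        hBc.symm ha'c.symm ⟨cp, hcp⟩ ⟨cq, hcq⟩ hb'c.symm hAc.symm

lemma caseII (hM : M.IsModelOf G) (hH : M.Helly) (hN : NoHole G) (hS : IsEmpty (sun3 ↪g G))
    (hR : ∀ n : ℕ, 4 ≤ n → IsEmpty (risingSun n ↪g G)) (hU : IsEmpty (umbrella ↪g G))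
    {A B a b c : V} (hc : M.Cov A B) (hAc : Miss G A c) (hBa : Miss G B a) (hBb : Miss G B b)
    (hab : Miss G a b) (hC : Conn G a b c) (hC' : Conn G b a c) : False := by
  obtain ⟨B', ⟨hc', hB'a, hB'b⟩, hmax⟩ := Set.Finite.exists_maximalFor M.P
    {z | M.Cov A z ∧ Miss G z a ∧ Miss G z b} (Set.toFinite _) ⟨B, hc, hBa, hBb⟩
  have hmax' : ∀ z, M.Cov A z → Miss G z a → Miss G z b →
      ¬ (M.P B' ⊆ M.P z ∧ M.pt B' ∈ M.P z) := by
    rintro z h1 h2 h3 ⟨h4, h5⟩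
    exact M.pt_notMem B' (hmax ⟨h1, h2, h3⟩ h4 h5)
  clear hmax hc hBa hBb B
  rename' B' => B, hc' => hc, hB'a => hBa, hB'b => hBb
  have hAB := hc.inter
  have inA : ∀ z, Miss G B z → G.Adj A z := by
    intro z hz
    exact adj_of_ne hM (inter_ne hM (M.inter_symm (M.inter_symm hAB)) hz.symm |> fun h => by
      rintro rfl; exact (miss_iff hM).1 hz (M.inter_symm hAB))
      (inter_of_cov hM hc.symm hz (M.inter_self _))
  have hAa := inA a hBa
  have hAb := inA b hBb
  have hBc : G.Adj B c := by
    refine adj_of_ne hM ?_ (inter_of_cov hM hc hAc (M.inter_self _))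
    rintro rfl; exact (miss_iff hM).1 hAc hAB
  have nBc : ¬ Miss G B c := fun h => h.2 hBc
  obtain ⟨a', p, ra, hBa', ⟨ha'p, -, hbp⟩, hBp⟩ := exists_exit (P := fun z => Miss G B z) hC' hBa nBc
  obtain ⟨b', q, rb, hBb', ⟨hb'q, -, haq⟩, hBq⟩ := exists_exit (P := fun z => Miss G B z) hC hBb nBc
  have hBp : G.Adj B p := by
    refine adj_of_ne hM ?_ (not_miss hM hBp)
    rintro rfl; exact hBa'.2 ha'p.symm
  have hBq : G.Adj B q := by
    refine adj_of_ne hM ?_ (not_miss hM hBq)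
    rintro rfl; exact hBb'.2 hb'q.symm
  have hAa' := inA a' hBa'
  have hAb' := inA b' hBb'
  have hAp : G.Adj A p := by
    refine adj_of_ne hM ?_ (inter_of_cov hM hc.symm hBa' (adj_inter hM ha'p))
    rintro rfl; exact hbp.2 hAb.symm
  have hAq : G.Adj A q := by
    refine adj_of_ne hM ?_ (inter_of_cov hM hc.symm hBb' (adj_inter hM hb'q))
    rintro rfl; exact haq.2 hAa.symm
  have inc : ∀ z, Miss G B z → Miss G z c := by
    intro z hz
    rw [miss_iff hM]
    intro h
    exact (miss_iff hM).1 hAc (inter_of_cov hM hc.symm hz h)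
  have np := nonwrap hM hS hR hc hmax' hAc hAa hBa hBb hbp.symm (adj_inter hM hBp) hC
  have nq := nonwrap hM hS hR hc (fun z h1 h2 h3 => hmax' z h1 h3 h2) hAc hAb hBb hBa haq.symm
    (adj_inter hM hBq) hC'
  obtain ⟨g, hg, -⟩ := M.inter_self B
  have hg : g ∈ M.P B := hg
  have un : ∀ z, Miss G B z → g ∉ M.P z := fun z hz => hz.disj hM hg
  have sa : ∀ x y, ((G.Adj x y ∧ Miss G b x ∧ Miss G b y) ∧ Miss G B x ∧ Miss G B y) →
      M.Inter x y ∧ g ∉ M.P x ∧ g ∉ M.P y ∧ ¬ M.Inter y b := by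
    rintro x y ⟨⟨h1, h2, h3⟩, h4, h5⟩
    exact ⟨adj_inter hM h1, un _ h4, un _ h5, (miss_iff hM).1 h3.symm⟩
  have sb : ∀ x y, ((G.Adj x y ∧ Miss G a x ∧ Miss G a y) ∧ Miss G B x ∧ Miss G B y) →
      M.Inter x y ∧ g ∉ M.P x ∧ g ∉ M.P y ∧ ¬ M.Inter y a := by
    rintro x y ⟨⟨h1, h2, h3⟩, h4, h5⟩
    exact ⟨adj_inter hM h1, un _ h4, un _ h5, (miss_iff hM).1 h3.symm⟩
  rcases unc_miss (un a hBa) (un b hBb) ((miss_iff hM).1 hab) with h | h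
  · have l1 := stay_left (un b hBb) sa ra h
    have l2 := stay_right (un a hBa) sb rb h
    have := orient hM hg hBa hBb hBa' hBb' (adj_inter hM hBp) (adj_inter hM hBq)
      (adj_inter hM ha'p.symm) (adj_inter hM hb'q.symm) hbp.symm haq.symm np nq
      (dist_of_le (un a' hBa') (un b hBb) l1) (dist_of_le (un a hBa) (un b' hBb') l2)
    exact finish hM hH hN hS hR hU hc hAc hAa hAa' hAb hAb' hAp hAq hBa hBb hBa' hBb' hBc hBp hBq
      ha'p.symm hb'q.symm hbp.symm haq.symm (inc _ hBa') (inc _ hBb') hC hC' this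
  · have l1 := stay_right (un b hBb) sa ra h
    have l2 := stay_left (un a hBa) sb rb h
    have := orient hM hg hBb hBa hBb' hBa' (adj_inter hM hBq) (adj_inter hM hBp)
      (adj_inter hM hb'q.symm) (adj_inter hM ha'p.symm) haq.symm hbp.symm nq np
      (dist_of_le (un b' hBb') (un a hBa) l2) (dist_of_le (un b hBb) (un a' hBa') l1)
    exact finish hM hH hN hS hR hU hc hAc hAb hAb' hAa hAa' hAq hAp hBb hBa hBb' hBa' hBc hBq hBp
      hb'q.symm ha'p.symm haq.symm hbp.symm (inc _ hBb') (inc _ hBa') hC' hC this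

lemma core (hM : M.IsModelOf G) (hH : M.Helly) (hN : NoHole G) (hS : IsEmpty (sun3 ↪g G))
    (hR : ∀ n : ℕ, 4 ≤ n → IsEmpty (risingSun n ↪g G)) (hU : IsEmpty (umbrella ↪g G))
    {A B a b c : V} (hc : M.Cov A B) (hAc : Miss G c A) (hBa : Miss G a B) (hAT : AT G a b c) :
    False := by
  have hAc := hAc.symm
  have hBa := hBa.symm
  obtain ⟨hab, hac, hbc, cc, cb, ca⟩ := hAT
  by_cases hBb : Miss G B b
  · exact caseII hM hH hN hS hR hU hc hAc hBa hBb hab ca cb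
  by_cases hAb : Miss G A b
  · exact caseII hM hH hN hS hR hU hc.symm hBa hAc hAb hbc.symm cc.symm cb.symm
  have iA : M.Inter A a := inter_of_cov hM hc.symm hBa (M.inter_self _)
  have iB : M.Inter B c := inter_of_cov hM hc hAc (M.inter_self _)
  refine caseI hM hS hR (u := b) hc hAc hBa (adj_of_ne hM ?_ (not_miss hM hAb))
    (adj_of_ne hM ?_ (not_miss hM hBb)) cb
  · rintro rfl; exact (miss_iff hM).1 hab.symm iA
  · rintro rfl; exact (miss_iff hM).1 hbc iB

lemma noAT (hM : M.IsModelOf G) (hH : M.Helly) (hN : NoHole G) (hS : IsEmpty (sun3 ↪g G))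
    (hR : ∀ n : ℕ, 4 ≤ n → IsEmpty (risingSun n ↪g G)) (hU : IsEmpty (umbrella ↪g G))
    {a b c : V} (hAT : AT G a b c) : False := by
  obtain ⟨A, B, hA, hB, hc⟩ := two_cover hM hH hN
    (fun z => Miss G a z ∨ Miss G b z ∨ Miss G c z) (at_cover hM hAT)
  have same : ∀ z, Miss G z A → Miss G z B → False := by
    intro z h1 h2
    obtain ⟨y, hy, -⟩ := M.inter_self z
    rcases hc y with h | h
    · exact h1.disj hM hy h
    · exact h2.disj hM hy h
  rcases hA with hA | hA | hA <;> rcases hB with hB | hB | hB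
  · exact same _ hA hB
  · exact core hM hH hN hS hR hU hc hA hB hAT.swap12.swap23
  · exact core hM hH hN hS hR hU hc hA hB hAT.swap12.swap23.swap12
  · exact core hM hH hN hS hR hU hc hA hB hAT.swap23
  · exact same _ hA hB
  · exact core hM hH hN hS hR hU hc hA hB hAT.swap23.swap12
  · exact core hM hH hN hS hR hU hc hA hB hAT
  · exact core hM hH hN hS hR hU hc hA hB hAT.swap12
  · exact same _ hA hB

end noAT


section rep
variable {V : Type} {G : SimpleGraph V}

/-- a clique path for the subgraph induced by `W` -/
structure CliqRep (G : SimpleGraph V) (W : Set V) (k : ℕ) (Q : ℕ → Set V) : Prop where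
  sub : ∀ i < k, ∀ v ∈ Q i, v ∈ W
  clq : ∀ i < k, ∀ u ∈ Q i, ∀ v ∈ Q i, ¬ Miss G u v
  edge : ∀ u ∈ W, ∀ v ∈ W, ¬ Miss G u v → ∃ i < k, u ∈ Q i ∧ v ∈ Q i
  cons : ∀ i j l v, i ≤ j → j ≤ l → l < k → v ∈ Q i → v ∈ Q l → v ∈ Q j

lemma rtg_mono {R R' : V → V → Prop} {u v : V} (h : ReflTransGen R u v)
    (hh : ∀ a b, R a b → R' a b) : ReflTransGen R' u v :=
  ReflTransGen.mono hh _ _ h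

lemma not_miss_self (v : V) : ¬ Miss G v v := fun h => h.1 rfl

lemma CliqRep.helly [Finite V] {W : Set V} {k : ℕ} {Q : ℕ → Set V} (h : CliqRep G W k Q) (hk : 0 < k)
    (K : Set V) (hK : K ⊆ W) (hc : ∀ u ∈ K, ∀ v ∈ K, ¬ Miss G u v) : ∃ i < k, K ⊆ Q i := by
  classical
  rcases K.eq_empty_or_nonempty with rfl | hne
  · exact ⟨0, hk, by simp⟩
  have hex : ∀ v : V, ∃ i, v ∈ K → (i < k ∧ v ∈ Q i ∧ ∀ j, j < k → v ∈ Q j → i ≤ j) := by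
    intro v
    by_cases hv : v ∈ K
    · obtain ⟨i, hi, hi', -⟩ := h.edge v (hK hv) v (hK hv) (not_miss_self v)
      have hex : ∃ i, i < k ∧ v ∈ Q i := ⟨i, hi, hi'⟩
      exact ⟨Nat.find hex, fun _ => ⟨(Nat.find_spec hex).1, (Nat.find_spec hex).2,
        fun j h1 h2 => Nat.find_min' hex ⟨h1, h2⟩⟩⟩
    · exact ⟨0, fun h => absurd h hv⟩
  choose F hF using hex
  obtain ⟨s, hs, hmax⟩ := Set.exists_max_image K F (Set.toFinite K) hne
  refine ⟨F s, (hF s hs).1, fun v hv => ?_⟩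
  obtain ⟨j, hj, h1, h2⟩ := h.edge v (hK hv) s (hK hs) (hc v hv s hs)
  exact h.cons (F v) (F s) j v (hmax v hv) ((hF s hs).2.2 j hj h2) hj (hF v hv).2.1 h1

lemma CliqRep.flip {W : Set V} {k : ℕ} {Q : ℕ → Set V} (h : CliqRep G W k Q) {p : ℕ} (hp : p < k)
    (hc : p + 1 = k ∨ Q p ∩ Q (p+1) ⊆ Q 0) :
    CliqRep G W k (fun t => if t ≤ p then Q (p - t) else Q t) := by
  refine ⟨?_, ?_, ?_, ?_⟩
  · intro i hi v hv
    split_ifs at hv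
    · exact h.sub (p - i) (by omega) v hv
    · exact h.sub i hi v hv
  · intro i hi u hu v hv
    split_ifs at hu hv
    · exact h.clq (p - i) (by omega) u hu v hv
    · exact h.clq i hi u hu v hv
  · intro u hu v hv huv
    obtain ⟨i, hi, h1, h2⟩ := h.edge u hu v hv huv
    by_cases hip : i ≤ p
    · refine ⟨p - i, by omega, ?_⟩
      have e1 : p - i ≤ p := by omega
      have e2 : p - (p - i) = i := by omega
      simp only [e1, if_true, e2]; exact ⟨h1, h2⟩
    · refine ⟨i, hi, ?_⟩
      simp only [hip, if_false]; exact ⟨h1, h2⟩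
  · intro i j l v hij hjl hl hi' hl'
    by_cases c1 : l ≤ p
    · have c2 : j ≤ p := by omega
      have c3 : i ≤ p := by omega
      simp only [c1, c2, c3, if_true] at hi' hl' ⊢
      exact h.cons (p - l) (p - j) (p - i) v (by omega) (by omega) (by omega) hl' hi'
    · by_cases c3 : i ≤ p
      · simp only [c1, c3, if_true, if_false] at hi' hl'
        have h1 : v ∈ Q p := h.cons (p-i) p l v (by omega) (by omega) hl hi' hl'
        have h2 : v ∈ Q (p+1) := h.cons (p-i) (p+1) l v (by omega) (by omega) hl hi' hl'
        have h0 : v ∈ Q 0 := by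
          rcases hc with hc | hc
          · omega
          · exact hc ⟨h1, h2⟩
        split_ifs
        · exact h.cons 0 (p-j) l v (by omega) (by omega) hl h0 hl'
        · exact h.cons 0 j l v (by omega) (by omega) hl h0 hl'
      · have c2 : ¬ j ≤ p := by omega
        simp only [c1, c2, c3, if_false] at hi' hl' ⊢
        exact h.cons i j l v hij hjl hl hi' hl'

lemma CliqRep.del {W : Set V} {k : ℕ} {Q : ℕ → Set V} (h : CliqRep G W k Q) {i j : ℕ} (hi : i < k)
    (hj : j < k) (hij : i ≠ j) (hs : Q i ⊆ Q j) :
    CliqRep G W (k-1) (fun t => if t < i then Q t else Q (t+1)) := by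
  refine ⟨?_, ?_, ?_, ?_⟩
  · intro t ht v hv
    split_ifs at hv
    · exact h.sub t (by omega) v hv
    · exact h.sub (t+1) (by omega) v hv
  · intro t ht u hu v hv
    split_ifs at hu hv
    · exact h.clq t (by omega) u hu v hv
    · exact h.clq (t+1) (by omega) u hu v hv
  · intro u hu v hv huv
    have key : ∃ t < k, t ≠ i ∧ u ∈ Q t ∧ v ∈ Q t := by
      obtain ⟨t, ht, h1, h2⟩ := h.edge u hu v hv huv
      by_cases hti : t = i
      · subst hti; exact ⟨j, hj, hij.symm, hs h1, hs h2⟩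
      · exact ⟨t, ht, hti, h1, h2⟩
    obtain ⟨t, ht, hti, h1, h2⟩ := key
    by_cases c : t < i
    · refine ⟨t, by omega, ?_⟩
      simp only [c, if_true]; exact ⟨h1, h2⟩
    · refine ⟨t - 1, by omega, ?_⟩
      have c' : ¬ t - 1 < i := by omega
      have e : t - 1 + 1 = t := by omega
      simp only [c', if_false, e]; exact ⟨h1, h2⟩
  · intro a b c v hab hbc hc h1 h2
    split_ifs at * <;> first | omega | exact h.cons _ _ _ v (by omega) (by omega) (by omega) h1 h2

lemma conn_step {c u v : V} (h : ¬ Miss G u v) (h1 : Miss G c u) (h2 : Miss G c v) :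
    Conn G c u v := by
  by_cases e : u = v
  · subst e; exact .refl
  · have : G.Adj u v := by
      by_contra h'; exact h ⟨e, h'⟩
    exact .single ⟨this, h1, h2⟩

lemma rep_core [Finite V] (hAT : ∀ a b c, ¬ AT G a b c) {C S : Set V} {x : V}
    (hS : ∀ u ∈ S, ∀ v ∈ S, ¬ Miss G u v) (hSx : ∀ s ∈ S, G.Adj x s)
    (hCx : ∀ c ∈ C, Miss G x c) (hne : C.Nonempty)
    (hC : ∀ u ∈ C, ∀ v ∈ C, ReflTransGen (fun a b => G.Adj a b ∧ a ∈ C ∧ b ∈ C) u v)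
    (hrep : ∃ k Q, CliqRep G (C ∪ S) k Q) :
    ∃ k Q, CliqRep G (C ∪ S) k Q ∧ 0 < k ∧ S ⊆ Q 0 := by
  classical
  have hpos : ∀ {k Q}, CliqRep G (C ∪ S) k Q → 0 < k := by
    intro k Q h
    obtain ⟨c, hc⟩ := hne
    obtain ⟨i, hi, -⟩ := h.edge c (Or.inl hc) c (Or.inl hc) (not_miss_self c)
    omega
  obtain ⟨Q0, hQ0⟩ := Nat.find_spec hrep
  have hkmin : ∀ k' < Nat.find hrep, ∀ Q, ¬ CliqRep G (C ∪ S) k' Q :=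
    fun k' hk' Q h => Nat.find_min hrep hk' ⟨Q, h⟩
  generalize Nat.find hrep = k at *
  have hk := hpos hQ0
  have hex : ∃ i, ∃ Q, CliqRep G (C ∪ S) k Q ∧ i < k ∧ S ⊆ Q i := by
    obtain ⟨i, hi, h⟩ := hQ0.helly hk S (fun s hs => Or.inr hs) hS
    exact ⟨i, Q0, hQ0, hi, h⟩
  clear hQ0 Q0
  obtain ⟨Q, hQ, hik, hSi⟩ := Nat.find_spec hex
  have himin : ∀ i' < Nat.find hex, ∀ Q, CliqRep G (C ∪ S) k Q → ¬ S ⊆ Q i' :=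
    fun i' hi' Q h h' => Nat.find_min hex hi' ⟨Q, h, by omega, h'⟩
  generalize Nat.find hex = i at *
  rcases Nat.eq_zero_or_pos i with rfl | hi
  · exact ⟨k, Q, hQ, hk, hSi⟩
  exfalso
  have hexj : ∃ p, i ≤ p ∧ p < k ∧ (p + 1 = k ∨ Q p ∩ Q (p+1) ⊆ Q 0) :=
    ⟨k - 1, by omega, by omega, Or.inl (by omega)⟩
  obtain ⟨hij, hjk, hjc⟩ := Nat.find_spec hexj
  have hjmin : ∀ p, i ≤ p → p < Nat.find hexj → ¬ Q p ∩ Q (p+1) ⊆ Q 0 :=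
    fun p h1 h2 h3 => Nat.find_min hexj h2 ⟨h1, by omega, Or.inr h3⟩
  generalize Nat.find hexj = j at *
  have hfl := hQ.flip hjk hjc
  have hSj : ¬ S ⊆ Q j := by
    have := himin 0 hi _ hfl
    simpa using this
  have hij' : i < j := by
    rcases Nat.lt_or_ge i j with h | h
    · exact h
    · have : i = j := by omega
      subst this; exact absurd hSi hSj
  have hg : ∀ t < i, ¬ Q t ∩ Q (t+1) ⊆ Q j := by
    intro t ht hsub
    have hf2 := hfl.flip (p := j - t - 1) (by omega) (Or.inr (by
      have e1 : j - t - 1 ≤ j := by omega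
      have e2 : j - t - 1 + 1 ≤ j := by omega
      have e3 : j - (j - t - 1) = t + 1 := by omega
      have e4 : j - (j - t - 1 + 1) = t := by omega
      simp only [e1, e2, if_true, e3, e4, Nat.zero_le, Nat.sub_zero]
      rw [Set.inter_comm]; exact hsub))
    refine himin (i - t - 1) (by omega) _ hf2 ?_
    have e1 : i - t - 1 ≤ j - t - 1 := by omega
    have e2 : j - t - 1 - (i - t - 1) ≤ j := by omega
    have e3 : j - (j - t - 1 - (i - t - 1)) = i := by omega
    simp only [e1, e2, if_true, e3]; exact hSi
  obtain ⟨s, hs, hsj⟩ := Set.not_subset.1 hSj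
  obtain ⟨s', hs', hs0⟩ := Set.not_subset.1 (himin 0 hi _ hQ)
  have hdel : ∀ p q, p < k → q < k → p ≠ q → ∃ a ∈ Q p, a ∉ Q q := by
    intro p q hp hq hpq
    by_contra hcon
    push Not at hcon
    exact hkmin (k-1) (by omega) _ (hQ.del hp hq hpq hcon)
  obtain ⟨a, ha, ha1⟩ := hdel 0 1 (by omega) (by omega) (by omega)
  obtain ⟨b, hb, hb1⟩ := hdel j (j-1) (by omega) (by omega) (by omega)
  have hap : ∀ t, t < k → a ∈ Q t → t = 0 := by
    intro t ht h
    by_contra h0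
    exact ha1 (hQ.cons 0 1 t a (by omega) (by omega) ht ha h)
  have hbp1 : ∀ t, t < j → b ∉ Q t := by
    intro t ht h
    exact hb1 (hQ.cons t (j-1) j b (by omega) (by omega) (by omega) h hb)
  have hbp : ∀ t, t < k → b ∈ Q t → t = j := by
    intro t ht h
    rcases lt_trichotomy t j with h' | h' | h'
    · exact absurd h (hbp1 t h')
    · exact h'
    · rcases hjc with hjc | hjc
      · omega
      · have := hQ.cons j (j+1) t b (by omega) (by omega) ht hb h
        exact absurd (hjc ⟨hb, this⟩) (hbp1 0 (by omega))
  have haC : a ∈ C := by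
    rcases hQ.sub 0 hk a ha with h | h
    · exact h
    · have := hap i hik (hSi h); omega
  have hbC : b ∈ C := by
    rcases hQ.sub j hjk b hb with h | h
    · exact h
    · exact absurd (hSi h) (hbp1 i hij')
  have hsW : ∀ t < k, ∀ u ∈ Q t, u ∈ C ∪ S := hQ.sub
  have hma : ∀ t < k, ∀ u ∈ Q t, u ∉ Q 0 → Miss G a u := by
    intro t ht u hu hu0
    by_contra h
    obtain ⟨r, hr, h1, h2⟩ := hQ.edge a (Or.inl haC) u (hsW t ht u hu) h
    have := hap r hr h1
    subst this; exact hu0 h2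
  have hmb : ∀ t < k, ∀ u ∈ Q t, u ∉ Q j → Miss G b u := by
    intro t ht u hu hu0
    by_contra h
    obtain ⟨r, hr, h1, h2⟩ := hQ.edge b (Or.inl hbC) u (hsW t ht u hu) h
    have := hbp r hr h1
    subst this; exact hu0 h2
  have hab : Miss G a b := hma j hjk b hb (hbp1 0 (by omega))
  have p1 : ∀ t, t ≤ i → ∀ u ∈ Q t, u ∉ Q j → Conn G b u a := by
    intro t
    induction t with
    | zero =>
      intro _ u hu huj
      exact conn_step (hQ.clq 0 hk u hu a ha) (hmb 0 hk u hu huj) hab.symm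
    | succ t ih =>
      intro ht u hu huj
      obtain ⟨g, ⟨hg1, hg2⟩, hg3⟩ := Set.not_subset.1 (hg t (by omega))
      exact (conn_step (hQ.clq (t+1) (by omega) u hu g hg2) (hmb (t+1) (by omega) u hu huj)
        (hmb t (by omega) g hg1 hg3)).trans (ih (by omega) g hg1 hg3)
  have p2 : ∀ r t, t + r = j → i ≤ t → ∀ u ∈ Q t, u ∉ Q 0 → Conn G a u b := by
    intro r
    induction r with
    | zero =>
      intro t ht _ u hu hu0
      have ht : t = j := by omega
      subst ht
      exact conn_step (hQ.clq t hjk u hu b hb) (hma t hjk u hu hu0) hab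
    | succ r ih =>
      intro t ht hit u hu hu0
      obtain ⟨g, ⟨hg1, hg2⟩, hg3⟩ := Set.not_subset.1 (hjmin t hit (by omega))
      exact (conn_step (hQ.clq t (by omega) u hu g hg1) (hma t (by omega) u hu hu0)
        (hma t (by omega) g hg1 hg3)).trans (ih (t+1) (by omega) (by omega) g hg2 hg3)
  have hx1 : Miss G x a := hCx a haC
  have hx2 : Miss G x b := hCx b hbC
  refine hAT x a b ⟨hx1, hx2, hab, ?_, ?_, ?_⟩
  · exact ReflTransGen.head ⟨hSx s hs, hx2.symm, hmb i hik s (hSi hs) hsj⟩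
      (p1 i le_rfl s (hSi hs) hsj)
  · exact ReflTransGen.head ⟨hSx s' hs', hx1.symm, hma i hik s' (hSi hs') hs0⟩
      (p2 (j-i) i (by omega) le_rfl s' (hSi hs') hs0)
  · exact rtg_mono (hC a haC b hbC) (fun u v h => ⟨h.1, hCx u h.2.1, hCx v h.2.2⟩)

lemma rep_combine {D C S : Set V} {m k : ℕ} {P Q : ℕ → Set V} (hP : CliqRep G D m P)
    (hQ : CliqRep G (C ∪ S) k Q) (hk : 0 < k) (hS0 : S ⊆ Q 0) (hd : ∀ v ∈ D, v ∉ C ∧ v ∉ S)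
    (hDS : ∀ d ∈ D, ∀ s ∈ S, G.Adj d s) (hDC : ∀ d ∈ D, ∀ c ∈ C, Miss G d c) :
    CliqRep G (D ∪ (C ∪ S)) (m + k) (fun t => if t < m then P t ∪ S else Q (t - m)) := by
  refine ⟨?_, ?_, ?_, ?_⟩
  · intro t ht v hv
    split_ifs at hv with h
    · rcases hv with hv | hv
      · exact Or.inl (hP.sub t h v hv)
      · exact Or.inr (Or.inr hv)
    · exact Or.inr (hQ.sub (t-m) (by omega) v hv)
  · intro t ht u hu v hv
    split_ifs at hu hv with h
    · rcases hu with hu | hu <;> rcases hv with hv | hv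
      · exact hP.clq t h u hu v hv
      · exact fun h' => h'.2 (hDS u (hP.sub t h u hu) v hv)
      · exact fun h' => h'.2 (hDS v (hP.sub t h v hv) u hu).symm
      · exact hQ.clq 0 hk u (hS0 hu) v (hS0 hv)
    · exact hQ.clq (t-m) (by omega) u hu v hv
  · have mixed : ∀ u ∈ D, ∀ v ∈ C ∪ S, ¬ Miss G u v → ∃ i < m + k,
        u ∈ (if i < m then P i ∪ S else Q (i - m)) ∧ v ∈ (if i < m then P i ∪ S else Q (i - m)) := by
      intro u hu v hv huv
      rcases hv with hv | hv
      · exact absurd (hDC u hu v hv) huv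
      · obtain ⟨i, hi, h1, -⟩ := hP.edge u hu u hu (not_miss_self u)
        refine ⟨i, by omega, ?_⟩
        simp only [hi, if_true]; exact ⟨Or.inl h1, Or.inr hv⟩
    intro u hu v hv huv
    rcases hu with hu | hu <;> rcases hv with hv | hv
    · obtain ⟨i, hi, h1, h2⟩ := hP.edge u hu v hv huv
      refine ⟨i, by omega, ?_⟩
      simp only [hi, if_true]; exact ⟨Or.inl h1, Or.inl h2⟩
    · exact mixed u hu v hv huv
    · obtain ⟨i, hi, h1, h2⟩ := mixed v hv u hu (fun h => huv h.symm)
      exact ⟨i, hi, h2, h1⟩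
    · obtain ⟨i, hi, h1, h2⟩ := hQ.edge u hu v hv huv
      refine ⟨m + i, by omega, ?_⟩
      have c : ¬ m + i < m := by omega
      have e : m + i - m = i := by omega
      simp only [c, if_false, e]; exact ⟨h1, h2⟩
  · intro i j l v hij hjl hl h1 h2
    by_cases hSv : v ∈ S
    · split_ifs at * with c1 c2 c3 <;> first
        | exact Or.inr hSv
        | omega
        | exact hQ.cons 0 (j-m) (l-m) v (by omega) (by omega) (by omega) (hS0 hSv) h2
    · by_cases c1 : l < m
      · have c2 : j < m := by omega
        have c3 : i < m := by omega
        simp only [c1, c2, c3, if_true] at h1 h2 ⊢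
        left
        exact hP.cons i j l v hij hjl c1 (h1.resolve_right hSv) (h2.resolve_right hSv)
      · by_cases c3 : i < m
        · simp only [c1, c3, if_true, if_false] at h1 h2
          have h3 := hd v (hP.sub i c3 v (h1.resolve_right hSv))
          rcases hQ.sub (l-m) (by omega) v h2 with h | h
          · exact absurd h h3.1
          · exact absurd h h3.2
        · have c2 : ¬ j < m := by omega
          simp only [c1, c2, c3, if_false] at h1 h2 ⊢
          exact hQ.cons (i-m) (j-m) (l-m) v (by omega) (by omega) (by omega) h1 h2

/-- component of `c` in `W` minus the closed neighbourhood of `x` -/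
def Cp (G : SimpleGraph V) (W : Set V) (x c : V) : Set V :=
  {v | v ∈ W ∧ Miss G x v ∧ ReflTransGen
    (fun u v => G.Adj u v ∧ (u ∈ W ∧ Miss G x u) ∧ (v ∈ W ∧ Miss G x v)) c v}

theorem exists_rep [Finite V] (hH : NoHole G) (hAT : ∀ a b c, ¬ AT G a b c) :
    ∀ (n : ℕ) (W : Set V), W.ncard = n → ∃ k Q, CliqRep G W k Q := by
  classical
  intro n
  induction n using Nat.strong_induction_on with
  | _ n ih =>
  intro W hWn
  by_cases hcl : ∀ u ∈ W, ∀ v ∈ W, ¬ Miss G u v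
  · exact ⟨1, fun _ => W, fun _ _ v hv => hv, fun _ _ => hcl,
      fun u hu v hv _ => ⟨0, by omega, hu, hv⟩, fun _ _ _ _ _ _ _ h _ => h⟩
  push Not at hcl
  obtain ⟨x0, hx0, c0, hc0, hm0⟩ := hcl
  obtain ⟨⟨x, c⟩, ⟨hx, hc, hxc⟩, hmax⟩ := Set.exists_max_image
    {q : V × V | q.1 ∈ W ∧ q.2 ∈ W ∧ Miss G q.1 q.2} (fun q => (Cp G W q.1 q.2).ncard)
    (Set.toFinite _) ⟨(x0, c0), hx0, hc0, hm0⟩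
  dsimp only at hx hc hxc hmax
  obtain ⟨C, hCdef⟩ : ∃ C, C = Cp G W x c := ⟨_, rfl⟩
  have hCW : ∀ v ∈ C, v ∈ W := by rintro v hv; rw [hCdef] at hv; exact hv.1
  have hCx : ∀ v ∈ C, Miss G x v := by rintro v hv; rw [hCdef] at hv; exact hv.2.1
  have hcC : c ∈ C := by rw [hCdef]; exact ⟨hc, hxc, .refl⟩
  have hCclosed : ∀ u ∈ C, ∀ v ∈ W, Miss G x v → G.Adj u v → v ∈ C := by
    intro u hu v hv hxv huv
    rw [hCdef] at hu ⊢
    exact ⟨hv, hxv, hu.2.2.tail ⟨huv, ⟨hu.1, hu.2.1⟩, hv, hxv⟩⟩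
  have hCpath : ∀ v ∈ C, ReflTransGen (fun a b => G.Adj a b ∧ a ∈ C ∧ b ∈ C) c v := by
    intro v hv
    rw [hCdef] at hv
    have h := hv.2.2
    have key : ∀ v, ReflTransGen
        (fun u v => G.Adj u v ∧ (u ∈ W ∧ Miss G x u) ∧ (v ∈ W ∧ Miss G x v)) c v →
        v ∈ C ∧ ReflTransGen (fun a b => G.Adj a b ∧ a ∈ C ∧ b ∈ C) c v := by
      intro v h
      induction h with
      | refl => exact ⟨hcC, .refl⟩
      | @tail b d _ hbd ihb =>
        have := hCclosed b ihb.1 d hbd.2.2.1 hbd.2.2.2 hbd.1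
        exact ⟨this, ihb.2.tail ⟨hbd.1, ihb.1, this⟩⟩
    exact (key v h).2
  have hCconn : ∀ u ∈ C, ∀ v ∈ C,
      ReflTransGen (fun a b => G.Adj a b ∧ a ∈ C ∧ b ∈ C) u v := by
    intro u hu v hv
    refine ReflTransGen.trans ?_ (hCpath v hv)
    rw [← reflTransGen_swap]
    exact rtg_mono (hCpath u hu) (fun a b h => ⟨h.1.symm, h.2.2, h.2.1⟩)
  obtain ⟨S, hSdef⟩ : ∃ S : Set V, S = {s | s ∈ W ∧ s ∉ C ∧ ∃ c' ∈ C, G.Adj s c'} := ⟨_, rfl⟩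
  have hSx : ∀ s ∈ S, G.Adj x s := by
    intro s hs
    rw [hSdef] at hs
    obtain ⟨h1, h2, c', h3, h4⟩ := hs
    by_contra h
    by_cases e : x = s
    · subst e; exact (hCx c' h3).2 h4
    · exact h2 (hCclosed c' h3 s h1 ⟨e, h⟩ h4.symm)
  obtain ⟨D, hDdef⟩ : ∃ D : Set V, D = {d | d ∈ W ∧ d ∉ C ∧ d ∉ S} := ⟨_, rfl⟩
  have hDC : ∀ d ∈ D, ∀ c' ∈ C, Miss G d c' := by
    intro d hd c' hc'
    rw [hDdef] at hd
    refine ⟨fun e => hd.2.1 (e ▸ hc'), fun h => hd.2.2 ?_⟩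
    rw [hSdef]; exact ⟨hd.1, hd.2.1, c', hc', h⟩
  have hDS : ∀ d ∈ D, ∀ s ∈ S, G.Adj d s := by
    intro d hd s hs
    by_contra h
    have hd' := hd
    rw [hDdef] at hd'
    have hds : Miss G d s := ⟨fun e => hd'.2.2 (e ▸ hs), h⟩
    have hs' := hs
    rw [hSdef] at hs'
    obtain ⟨h1, h2, c', h3, h4⟩ := hs'
    have hlt : (Cp G W x c).ncard < (Cp G W d c).ncard := by
      have hsub : ∀ v ∈ C, v ∈ Cp G W d c := by
        intro v hv
        refine ⟨hCW v hv, hDC d hd v hv, rtg_mono (hCpath v hv) ?_⟩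
        intro a b h
        exact ⟨h.1, ⟨hCW a h.2.1, hDC d hd a h.2.1⟩, hCW b h.2.2, hDC d hd b h.2.2⟩
      apply Set.ncard_lt_ncard _ (Set.toFinite _)
      rw [← hCdef]
      refine ⟨hsub, fun hh => h2 (hh ?_)⟩
      refine ⟨h1, hds, (hsub c' h3).2.2.tail ⟨h4.symm, ⟨hCW c' h3, hDC d hd c' h3⟩, h1, hds⟩⟩
    have := hmax (d, c) ⟨hd'.1, hc, hDC d hd c hcC⟩
    simp only at this
    omega
  have hScl : ∀ u ∈ S, ∀ v ∈ S, ¬ Miss G u v := by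
    intro s hs s' hs' hss
    have hs1 := hs
    have hs2 := hs'
    rw [hSdef] at hs1 hs2
    obtain ⟨h1, h2, c1, h3, h4⟩ := hs1
    obtain ⟨h1', h2', c1', h3', h4'⟩ := hs2
    obtain ⟨m, f, hA, hB, hR, hnR, hnA, hnB, hne⟩ := exists_shortest
      (fun a b => G.Adj a b ∧ a ∈ C ∧ b ∈ C) (fun u => u ∈ C ∧ G.Adj s u)
      (fun u => u ∈ C ∧ G.Adj s' u) ⟨c1, c1', ⟨h3, h4⟩, ⟨h3', h4'⟩, hCconn c1 h3 c1' h3'⟩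
    have hfC : ∀ t ≤ m, f t ∈ C := by
      intro t ht
      rcases Nat.lt_or_ge t m with h | h
      · exact (hR t h).2.1
      · have : t = m := by omega
        subst this; exact hB.1
    have hf : ∀ t t', t + 1 < t' → t' ≤ m → Miss G (f t) (f t') := fun t t' h h' =>
      ⟨hne t t' (by omega) h', fun hh => hnR t t' h h' ⟨hh, hfC t (by omega), hfC t' h'⟩⟩
    have hsf : ∀ t, 0 < t → t ≤ m → Miss G s (f t) := fun t h h' =>
      ⟨fun e => h2 (e ▸ hfC t h'), fun hh => hnA t h h' ⟨hfC t h', hh⟩⟩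
    have hsf' : ∀ t, t < m → Miss G (f t) s' := fun t h =>
      ⟨fun e => h2' (e ▸ hfC t (by omega)), fun hh => hnB t h ⟨hfC t (by omega), hh.symm⟩⟩
    refine hH _ _ (hole_apex (x := x) (m := m + 2)
      (f := fun t => if t = 0 then s else if t ≤ m + 1 then f (t-1) else s') (by omega)
      ?_ ?_ ?_ ?_ ?_)
    · intro t ht
      rcases Nat.eq_zero_or_pos t with rfl | h0
      · simpa using hA.2
      rcases Nat.lt_or_ge t (m+1) with h | h
      · have e1 : t ≠ 0 := by omega
        have e2 : t ≤ m + 1 := by omega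
        have e3 : t + 1 ≤ m + 1 := by omega
        have e4 : t + 1 - 1 = t - 1 + 1 := by omega
        simp only [e1, e2, e3, e4, if_true, if_false, Nat.succ_ne_zero]
        exact (hR (t-1) (by omega)).1
      · have : t = m + 1 := by omega
        subst this
        simpa using hB.2.symm
    · intro t t' htt ht'
      have e0 : t' ≠ 0 := by omega
      simp only [e0, if_false]
      rcases Nat.eq_zero_or_pos t with rfl | h0
      · simp only [if_true]
        split_ifs
        · exact hsf (t'-1) (by omega) (by omega)
        · exact hss
      · have e1 : t ≠ 0 := by omega
        have e2 : t ≤ m + 1 := by omega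
        simp only [e1, e2, if_true, if_false]
        split_ifs
        · exact hf (t-1) (t'-1) (by omega) (by omega)
        · exact hsf' (t-1) (by omega)
    · simpa using hSx s hs
    · simpa using hSx s' hs'
    · intro t h0 ht
      have e1 : t ≠ 0 := by omega
      have e2 : t ≤ m + 1 := by omega
      simp only [e1, e2, if_true, if_false]
      exact hCx _ (hfC _ (by omega))
  have hWeq : W = D ∪ (C ∪ S) := by
    ext v
    constructor
    · intro hv
      by_cases h1 : v ∈ C
      · exact Or.inr (Or.inl h1)
      by_cases h2 : v ∈ S
      · exact Or.inr (Or.inr h2)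
      · left; rw [hDdef]; exact ⟨hv, h1, h2⟩
    · rintro (h | h | h)
      · rw [hDdef] at h; exact h.1
      · exact hCW v h
      · rw [hSdef] at h; exact h.1
  have hlt1 : D.ncard < n := by
    rw [← hWn]
    apply Set.ncard_lt_ncard _ (Set.toFinite _)
    refine ⟨fun v hv => hWeq ▸ Or.inl hv, fun h => ?_⟩
    have := h hc
    rw [hDdef] at this
    exact this.2.1 hcC
  have hlt2 : (C ∪ S).ncard < n := by
    rw [← hWn]
    apply Set.ncard_lt_ncard _ (Set.toFinite _)
    refine ⟨fun v hv => hWeq ▸ Or.inr hv, fun h => ?_⟩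
    rcases h hx with h | h
    · exact (hCx x h).1 rfl
    · exact (hSx x h).ne rfl
  obtain ⟨k, Q, hQ, hk, hS0⟩ := rep_core hAT hScl hSx hCx ⟨c, hcC⟩ hCconn (ih _ hlt2 _ rfl)
  obtain ⟨m, P, hP⟩ := ih _ hlt1 _ rfl
  rw [hWeq]
  exact ⟨_, _, rep_combine hP hQ hk hS0 (fun v hv => by rw [hDdef] at hv; exact hv.2) hDS hDC⟩

end rep


section build
variable {V : Type} [Fintype V] {G : SimpleGraph V}

lemma model_of_intervals (a b : V → ℝ) (ha : ∀ v, 0 < a v) (hab : ∀ v, a v < b v)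
    (hb : ∀ v, b v < 1) (ia : Function.Injective a) (ib : Function.Injective b)
    (hne : ∀ u v, a u ≠ b v) :
    ∃ M : CAModel V, ∀ v p, p ∈ M.P v ↔ a v < coo 0 p ∧ coo 0 p < b v := by
  have hca : ∀ v, coo 0 ((a v : ℝ) : Circ) = a v := by
    intro v
    have := coo_of (0 : Circ) (r := a v) (ha v).le (by linarith [hab v, hb v])
    simpa using this
  have hcb : ∀ v, coo 0 ((b v : ℝ) : Circ) = b v := by
    intro v
    have := coo_of (0 : Circ) (r := b v) (by linarith [hab v, ha v]) (hb v)
    simpa using this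
  refine ⟨⟨fun v => ⟨(a v : ℝ), (b v : ℝ)⟩, ?_⟩, ?_⟩
  · rintro ⟨u, _ | _⟩ ⟨v, _ | _⟩ h <;> simp only [if_true, if_false, Bool.false_eq_true] at h <;>
      have h := congrArg (coo 0) h <;> simp only [hca, hcb] at h
    · rw [ib h]
    · exact absurd h.symm (hne v u)
    · exact absurd h (hne u v)
    · rw [ia h]
  · intro v p
    rw [CAModel.mem_P _ 0]
    simp only [CAModel.S, CAModel.T, hca, hcb]
    rw [arcR]
    have := hab v
    constructor
    · rintro (h | h | h)
      · exact h
      · linarith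
      · linarith
    · intro h; exact Or.inl h

lemma nhca_of_intervals (a b : V → ℝ) (ha : ∀ v, 0 < a v) (hab : ∀ v, a v < b v)
    (hb : ∀ v, b v < 1) (ia : Function.Injective a) (ib : Function.Injective b)
    (hne : ∀ u v, a u ≠ b v) (hG : ∀ u v, ¬ Miss G u v ↔ a u < b v ∧ a v < b u) :
    IsNHCAGraph G := by
  obtain ⟨M, hM⟩ := model_of_intervals a b ha hab hb ia ib hne
  have hI : ∀ u v, M.Inter u v ↔ a u < b v ∧ a v < b u := by
    intro u v
    constructor
    · rintro ⟨p, h1, h2⟩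
      have h1 := (hM u p).1 h1
      have h2 := (hM v p).1 h2
      constructor <;> linarith
    · rintro ⟨h1, h2⟩
      have h3 := hab u
      have h4 := hab v
      have h5 : max (a u) (a v) < min (b u) (b v) := by
        simp only [max_lt_iff, lt_min_iff]; tauto
      have h6 := le_max_left (a u) (a v)
      have h7 := le_max_right (a u) (a v)
      have h8 := min_le_left (b u) (b v)
      have h9 := min_le_right (b u) (b v)
      obtain ⟨p, hp⟩ := coo_surj 0 (r := (max (a u) (a v) + min (b u) (b v)) / 2)
        (by linarith [ha u]) (by linarith [hb u])
      refine ⟨p, (hM u p).2 ?_, (hM v p).2 ?_⟩ <;> rw [hp] <;> constructor <;> linarith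
  refine ⟨M, ?_, ?_, ?_⟩
  · intro u v _ h
    have h0 : (0 : Circ) ∈ (M.arc u).pts ∪ (M.arc v).pts := by rw [h]; trivial
    have key : ∀ w, (0 : Circ) ∉ M.P w := by
      intro w hw
      have := ((hM w 0).1 hw).1
      rw [coo_self] at this
      linarith [ha w]
    rcases h0 with h | h
    · exact key u h
    · exact key v h
  · intro S hS
    rcases S.eq_empty_or_nonempty with rfl | hne'
    · exact ⟨0, by simp⟩
    obtain ⟨u, hu, hu'⟩ := Set.exists_max_image S a (Set.toFinite S) hne'
    obtain ⟨w, hw, hw'⟩ := Set.exists_min_image S b (Set.toFinite S) hne'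
    have h1 := ((hI u w).1 (hS u hu w hw)).1
    obtain ⟨p, hp⟩ := coo_surj 0 (r := (a u + b w) / 2)
        (by linarith [ha u]) (by linarith [hb w])
    refine ⟨p, fun v hv => (hM v p).2 ?_⟩
    rw [hp]
    have := hu' v hv
    have := hw' v hv
    constructor <;> linarith
  · intro u v
    rw [hI, ← hG, Miss]
    constructor
    · intro h; exact ⟨h.ne, fun h' => h'.2 h⟩
    · rintro ⟨h1, h2⟩
      by_contra h
      exact h2 ⟨h1, h⟩

lemma int_close {p q : ℕ} {s t : ℝ} (h : |s| < 1/2) (ht : |t| < 1/2) (e : (p:ℝ) + s = q + t) :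
    p = q := by
  rw [abs_lt] at h ht
  rcases lt_trichotomy p q with h' | h' | h'
  · have : (p:ℝ) + 1 ≤ q := by exact_mod_cast h'
    linarith
  · exact h'
  · have : (q:ℝ) + 1 ≤ p := by exact_mod_cast h'
    linarith

theorem nhca_of_rep {k : ℕ} {Q : ℕ → Set V} (h : CliqRep G univ k Q) : IsNHCAGraph G := by
  classical
  have hex : ∀ v, ∃ l r, l ≤ r ∧ r < k ∧ v ∈ Q l ∧ v ∈ Q r ∧ ∀ t < k, v ∈ Q t → l ≤ t ∧ t ≤ r := by
    intro v
    obtain ⟨i, hi, hi', -⟩ := h.edge v trivial v trivial (not_miss_self v)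
    have hfin : {t | t < k ∧ v ∈ Q t}.Finite :=
      (Set.finite_lt_nat k).subset (fun t ht => ht.1)
    obtain ⟨l, hl, hl'⟩ := Set.exists_min_image {t | t < k ∧ v ∈ Q t} id hfin ⟨i, hi, hi'⟩
    obtain ⟨r, hr, hr'⟩ := Set.exists_max_image {t | t < k ∧ v ∈ Q t} id hfin ⟨i, hi, hi'⟩
    exact ⟨l, r, hl' r hr, hr.1, hl.2, hr.2, fun t h1 h2 => ⟨hl' t ⟨h1, h2⟩, hr' t ⟨h1, h2⟩⟩⟩
  choose L R hLR hRk hL hR hin using hex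
  have hadj : ∀ u v, ¬ Miss G u v ↔ L u ≤ R v ∧ L v ≤ R u := by
    intro u v
    constructor
    · intro hm
      obtain ⟨t, ht, h1, h2⟩ := h.edge u trivial v trivial hm
      have := hin u t ht h1
      have := hin v t ht h2
      omega
    · rintro ⟨h1, h2⟩
      have := hLR u
      have := hLR v
      have := hRk u
      have := hRk v
      refine h.clq (max (L u) (L v)) (by omega) u ?_ v ?_
      · exact h.cons (L u) _ (R u) u (by omega) (by omega) (by omega) (hL u) (hR u)
      · exact h.cons (L v) _ (R v) v (by omega) (by omega) (by omega) (hL v) (hR v)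
  obtain ⟨e, he0, he1, hei⟩ : ∃ e : V → ℝ, (∀ v, 0 < e v) ∧ (∀ v, e v < 1/4) ∧
      Function.Injective e := by
    refine ⟨fun v => ((Fintype.equivFin V v : ℕ) + 1 : ℝ) / (4 * (Fintype.card V + 1)), ?_, ?_, ?_⟩
    · intro v; positivity
    · intro v
      have h1 : ((Fintype.equivFin V v : ℕ) : ℝ) + 1 ≤ Fintype.card V := by
        exact_mod_cast (Fintype.equivFin V v).2
      rw [div_lt_div_iff₀ (by positivity) (by positivity)]
      linarith
    · intro u v huv
      dsimp only at huv
      have h0 : (4 * ((Fintype.card V : ℝ) + 1)) ≠ 0 := by positivity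
      rw [div_left_inj' h0] at huv
      have h1 : ((Fintype.equivFin V u : ℕ) : ℝ) = (Fintype.equivFin V v : ℕ) := by linarith
      have h2 : (Fintype.equivFin V u : ℕ) = (Fintype.equivFin V v : ℕ) := by exact_mod_cast h1
      exact (Fintype.equivFin V).injective (Fin.ext h2)
  have hk : (0:ℝ) < k + 1 := by positivity
  have hlt : ∀ u v, ((L u : ℝ) + e u) / (k+1) < (R v + 1/2 + e v) / (k+1) ↔ L u ≤ R v := by
    intro u v
    rw [div_lt_div_iff_of_pos_right hk]
    have := he0 u
    have := he0 v
    have := he1 u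
    have := he1 v
    constructor
    · intro h
      by_contra hc
      have : (R v : ℝ) + 1 ≤ L u := by exact_mod_cast (not_le.1 hc)
      linarith
    · intro h
      have : (L u : ℝ) ≤ R v := by exact_mod_cast h
      linarith
  refine nhca_of_intervals (fun v => ((L v : ℝ) + e v) / (k+1))
    (fun v => ((R v : ℝ) + 1/2 + e v) / (k+1)) ?_ ?_ ?_ ?_ ?_ ?_ ?_
  · intro v
    have := he0 v
    positivity
  · intro v
    exact (hlt v v).2 (hLR v)
  · intro v
    rw [div_lt_one hk]
    have : (R v : ℝ) + 1 ≤ k := by exact_mod_cast hRk v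
    linarith [he1 v]
  · intro u v huv
    dsimp only at huv
    rw [div_left_inj' hk.ne'] at huv
    have h1 : L u = L v := int_close (by rw [abs_lt]; constructor <;> linarith [he0 u, he1 u])
      (by rw [abs_lt]; constructor <;> linarith [he0 v, he1 v]) huv
    rw [h1] at huv
    exact hei (by linarith)
  · intro u v huv
    dsimp only at huv
    rw [div_left_inj' hk.ne'] at huv
    have h1 : R u = R v := int_close (s := e u) (t := e v)
      (by rw [abs_lt]; constructor <;> linarith [he0 u, he1 u])
      (by rw [abs_lt]; constructor <;> linarith [he0 v, he1 v]) (by linarith)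
    rw [h1] at huv
    exact hei (by linarith)
  · intro u v huv
    rw [div_left_inj' hk.ne'] at huv
    have h1 : L u = R v := int_close (s := e u - 1/4) (t := e v + 1/4)
      (by rw [abs_lt]; constructor <;> linarith [he0 u, he1 u])
      (by rw [abs_lt]; constructor <;> linarith [he0 v, he1 v]) (by linarith)
    rw [h1] at huv
    linarith [he0 u, he1 u, he0 v, he1 v]
  · intro u v
    rw [hlt, hlt, hadj]

end build


lemma noHole_of_peo {V : Type} {G : SimpleGraph V} (f : V → ℕ)
    (h : ∀ v a b, G.Adj v a → G.Adj v b → a ≠ b → f v ≤ f a → f v ≤ f b → G.Adj a b) :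
    NoHole G := by
  intro n u hu
  have hn := hu.1
  obtain ⟨i, hi, hmin⟩ := Finset.exists_min_image (Finset.range n) (fun i => f (u i))
    ⟨0, by simp; omega⟩
  simp only [Finset.mem_range] at hi hmin
  -- neighbours of `u i`
  have key : ∀ a b, a < n → b < n → a ≠ b → G.Adj (u i) (u a) → G.Adj (u i) (u b) →
      G.Adj (u a) (u b) := by
    intro a b ha hb hab h1 h2
    refine h _ _ _ h1 h2 ?_ (hmin a ha) (hmin b hb)
    rcases Nat.lt_or_gt_of_ne hab with h' | h'
    · exact hu.2.1 a b h' hb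
    · exact (hu.2.1 b a h' ha).symm
  have adj : ∀ a b, a < b → b < n → (G.Adj (u a) (u b) ↔ b = a + 1 ∨ (a = 0 ∧ b = n - 1)) := hu.2.2
  rcases Nat.eq_zero_or_pos i with rfl | h0
  · have := key 1 (n-1) (by omega) (by omega) (by omega) ((adj _ _ (by omega) (by omega)).2 (by omega))
      ((adj _ _ (by omega) (by omega)).2 (by omega))
    rw [adj _ _ (by omega) (by omega)] at this
    omega
  · by_cases h1 : i = n - 1
    · have := key 0 (i-1) (by omega) (by omega) (by omega)
        ((adj _ _ (by omega) (by omega)).2 (by omega)).symm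
        ((adj _ _ (by omega) (by omega)).2 (by omega)).symm
      rw [adj _ _ (by omega) (by omega)] at this
      omega
    · have := key (i-1) (i+1) (by omega) (by omega) (by omega)
        ((adj _ _ (by omega) (by omega)).2 (by omega)).symm
        ((adj _ _ (by omega) (by omega)).2 (by omega))
      rw [adj _ _ (by omega) (by omega)] at this
      omega

section forward
variable {V W : Type} [Fintype V] [Fintype W]

lemma nhca_comap {G : SimpleGraph V} {H : SimpleGraph W} (h : IsNHCAGraph G) (φ : H ↪g G) :
    IsNHCAGraph H := by
  obtain ⟨M, hN, hH, hM⟩ := h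
  refine ⟨⟨fun w => M.arc (φ w), ?_⟩, ?_, ?_, ?_⟩
  · rintro ⟨u, a⟩ ⟨v, b⟩ h
    have := M.endpoints_distinct (a₁ := (φ u, a)) (a₂ := (φ v, b)) h
    simp only [Prod.mk.injEq, EmbeddingLike.apply_eq_iff_eq] at this
    rw [this.1, this.2]
  · intro u v huv
    exact hN (φ u) (φ v) (fun h => huv (φ.injective h))
  · intro S hS
    obtain ⟨p, hp⟩ := hH (φ '' S) (by
      rintro _ ⟨u, hu, rfl⟩ _ ⟨v, hv, rfl⟩
      exact hS u hu v hv)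
    exact ⟨p, fun v hv => hp _ ⟨v, hv, rfl⟩⟩
  · intro u v
    rw [← φ.map_adj_iff, hM, ne_eq, ne_eq, EmbeddingLike.apply_eq_iff_eq]
    exact Iff.rfl

lemma nhca_no_at {G : SimpleGraph V} (h : IsNHCAGraph G) (hh : NoHole G) {a b c : V}
    (hat : AT G a b c) : False := by
  obtain ⟨M, hN, hH, hM⟩ := h
  obtain ⟨A, B, -, -, hc⟩ := two_cover hM hH hh (fun z => Miss G a z ∨ Miss G b z ∨ Miss G c z)
    (at_cover hM hat)
  exact hN A B hc.ne ((M.cov_iff_union).1 hc)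

lemma sun3_no : ¬ IsNHCAGraph sun3 := by
  intro h
  have hdec : ∀ u v, sun3.Adj u v ↔ u ≠ v ∧ ((((u : ℕ) < 3 ∧ (v : ℕ) < 3) ∨
    (3 ≤ (u : ℕ) ∧ ((v : ℕ) = (u : ℕ) - 3 ∨ (v : ℕ) = ((u : ℕ) - 2) % 3))) ∨
    (((v : ℕ) < 3 ∧ (u : ℕ) < 3) ∨
    (3 ≤ (v : ℕ) ∧ ((u : ℕ) = (v : ℕ) - 3 ∨ (u : ℕ) = ((v : ℕ) - 2) % 3)))) := by
    intro u v; rw [sun3, SimpleGraph.fromRel_adj]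
  refine nhca_no_at h (noHole_of_peo (fun v => if (v : ℕ) < 3 then 1 else 0) ?_)
    (a := 3) (b := 4) (c := 5) ?_
  · intro v a b
    simp only [hdec]
    have hv := v.2
    have ha := a.2
    have hb := b.2
    intro h1 h2 h3 h4 h5
    simp only [ne_eq, Fin.ext_iff] at *
    split_ifs at * <;> omega
  · refine ⟨?_, ?_, ?_, ?_, ?_, ?_⟩
    · simp only [Miss, hdec]; decide
    · simp only [Miss, hdec]; decide
    · simp only [Miss, hdec]; decide
    · refine .head (b := 1) ?_ (.single ?_) <;> simp only [Miss, hdec] <;> decide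
    · refine .head (b := 0) ?_ (.single ?_) <;> simp only [Miss, hdec] <;> decide
    · refine .head (b := 2) ?_ (.single ?_) <;> simp only [Miss, hdec] <;> decide

lemma umbrella_no : ¬ IsNHCAGraph umbrella := by
  intro h
  have hdec : ∀ u v, umbrella.Adj u v ↔ u ≠ v ∧
    ((((u : ℕ) < 5 ∧ (v : ℕ) = (u : ℕ) + 1 ∧ (v : ℕ) < 5) ∨
    ((u : ℕ) = 5 ∧ (v : ℕ) < 5) ∨ ((u : ℕ) = 6 ∧ (v : ℕ) = 2)) ∨
    (((v : ℕ) < 5 ∧ (u : ℕ) = (v : ℕ) + 1 ∧ (u : ℕ) < 5) ∨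
    ((v : ℕ) = 5 ∧ (u : ℕ) < 5) ∨ ((v : ℕ) = 6 ∧ (u : ℕ) = 2))) := by
    intro u v; rw [umbrella, SimpleGraph.fromRel_adj]
  refine nhca_no_at h (noHole_of_peo (fun v => if (v : ℕ) = 2 ∨ (v : ℕ) = 5 then 2 else
    if (v : ℕ) = 1 ∨ (v : ℕ) = 3 then 1 else 0) ?_) (a := 0) (b := 4) (c := 6) ?_
  · intro v a b
    simp only [hdec]
    have ha := a.2
    have hb := b.2
    obtain ⟨v, hv⟩ := v
    simp only [ne_eq, Fin.ext_iff] at *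
    intro h1 h2 h3
    clear hdec
    interval_cases v <;> intro h4 h5 <;> norm_num at h1 h2 h4 h5 <;>
      first
        | omega
        | (split_ifs at h4 <;> first | omega | (split_ifs at h5 <;> omega))
  · refine ⟨?_, ?_, ?_, ?_, ?_, ?_⟩
    · simp only [Miss, hdec]; decide
    · simp only [Miss, hdec]; decide
    · simp only [Miss, hdec]; decide
    · refine .head (b := 5) ?_ (.single ?_) <;> simp only [Miss, hdec] <;> decide
    · refine .head (b := 1) ?_ (.head (b := 2) ?_ (.single ?_)) <;>
        simp only [Miss, hdec] <;> decide
    · refine .head (b := 3) ?_ (.head (b := 2) ?_ (.single ?_)) <;>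
        simp only [Miss, hdec] <;> decide

lemma rs_ll (n : ℕ) (a b : Fin n) : (risingSun n).Adj (.inl a) (.inl b) ↔ a.val ≠ b.val ∧
    (((a : ℕ) = 0 ∨ (a : ℕ) = n - 1 ∨ (b : ℕ) = (a : ℕ) + 1) ∨
      ((b : ℕ) = 0 ∨ (b : ℕ) = n - 1 ∨ (a : ℕ) = (b : ℕ) + 1)) := by
  rw [risingSun, SimpleGraph.fromRel_adj]
  simp [Fin.ext_iff]

lemma rs_rl (n : ℕ) (w : Fin 3) (a : Fin n) : (risingSun n).Adj (.inr w) (.inl a) ↔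
        ((w : ℕ) = 0 ∧ ((a : ℕ) = 0 ∨ (a : ℕ) = 1)) ∨
        ((w : ℕ) = 1 ∧ ((a : ℕ) = n - 2 ∨ (a : ℕ) = n - 1)) ∨
        ((w : ℕ) = 2 ∧ ((a : ℕ) = n - 1 ∨ (a : ℕ) = 0)) := by
  rw [risingSun, SimpleGraph.fromRel_adj]
  simp

lemma rs_lr (n : ℕ) (w : Fin 3) (a : Fin n) : (risingSun n).Adj (.inl a) (.inr w) ↔
        ((w : ℕ) = 0 ∧ ((a : ℕ) = 0 ∨ (a : ℕ) = 1)) ∨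
        ((w : ℕ) = 1 ∧ ((a : ℕ) = n - 2 ∨ (a : ℕ) = n - 1)) ∨
        ((w : ℕ) = 2 ∧ ((a : ℕ) = n - 1 ∨ (a : ℕ) = 0)) := by
  rw [SimpleGraph.adj_comm, rs_rl]

lemma rs_rr (n : ℕ) (w w' : Fin 3) : ¬ (risingSun n).Adj (.inr w) (.inr w') := by
  rw [risingSun, SimpleGraph.fromRel_adj]
  simp

lemma rising_no (n : ℕ) (hn : 4 ≤ n) : ¬ IsNHCAGraph (risingSun n) := by
  intro h
  refine nhca_no_at h (noHole_of_peo (fun v => match v with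
    | .inr _ => 0
    | .inl a => if (a : ℕ) = 0 ∨ (a : ℕ) = n - 1 then n else a) ?_)
    (a := .inr 0) (b := .inr 1) (c := .inr 2) ?_
  · rintro (v | v) (a | a) (b | b) h1 h2 h3 h4 h5 <;>
      simp only [rs_ll, rs_lr, rs_rl, rs_rr, ne_eq, reduceCtorEq, not_false_eq_true,
        Sum.inl.injEq, Sum.inr.injEq, Fin.ext_iff] at * <;>
      have := v.2 <;> have := a.2 <;> have := b.2 <;>
      first
        | omega
        | (split_ifs at * <;> omega)
  · have hm1 : Miss (risingSun n) (.inr 0) (.inr 1) := ⟨by simp, rs_rr _ _ _⟩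
    have hm2 : Miss (risingSun n) (.inr 0) (.inr 2) := ⟨by simp, rs_rr _ _ _⟩
    have hm3 : Miss (risingSun n) (.inr 1) (.inr 2) := ⟨by simp, rs_rr _ _ _⟩
    refine ⟨hm1, hm2, hm3, ?_, ?_, ?_⟩
    · have key : ∀ t (ht : t + 1 < n - 1), Conn (risingSun n) (.inr 2) (.inr 0)
          (.inl ⟨t + 1, by omega⟩) := by
        intro t
        induction t with
        | zero =>
          intro ht
          refine .single ⟨?_, hm2.symm, by simp, ?_⟩
          · rw [rs_rl]; simp
          · rw [rs_rl]; simp; omega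
        | succ t ih =>
          intro ht
          refine (ih (by omega)).tail ⟨?_, ⟨by simp, ?_⟩, ⟨by simp, ?_⟩⟩
          · rw [rs_ll]; simp
          · rw [rs_rl]; simp; omega
          · rw [rs_rl]; simp; omega
      refine (key (n - 3) (by omega)).tail ⟨?_, ⟨by simp, ?_⟩, hm3.symm⟩
      · rw [rs_lr]; simp; omega
      · rw [rs_rl]; simp; omega
    · refine .head (b := .inl ⟨0, by omega⟩) ⟨?_, hm1.symm, ⟨by simp, ?_⟩⟩
        (.single ⟨?_, ⟨by simp, ?_⟩, hm3⟩)
      · rw [rs_rl]; simp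
      · rw [rs_rl]; simp; omega
      · rw [rs_lr]; simp
      · rw [rs_rl]; simp; omega
    · refine .head (b := .inl ⟨n - 1, by omega⟩) ⟨?_, hm1, ⟨by simp, ?_⟩⟩
        (.single ⟨?_, ⟨by simp, ?_⟩, hm2⟩)
      · rw [rs_rl]; simp
      · rw [rs_rl]; simp; omega
      · rw [rs_lr]; simp
      · rw [rs_rl]; simp; omega

lemma normal_convex {M : CAModel V} (hN : M.Normal) {h v : V} (hv : h ≠ v) {x y z : Circ}
    (hx : x ∈ M.P h) (hz : z ∈ M.P h) (hx' : x ∈ M.P v) (hz' : z ∈ M.P v)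
    (h1 : coo (M.ps h) x ≤ coo (M.ps h) y) (h2 : coo (M.ps h) y ≤ coo (M.ps h) z) :
    y ∈ M.P v := by
  by_contra hy
  refine hN h v hv ((M.cov_iff_union).1 fun p => ?_)
  have hs : M.S (M.ps h) h = 0 := coo_self _
  have f1 := M.facts (M.ps h) h
  have f2 := M.facts (M.ps h) v
  have f3 := coo_nonneg (M.ps h) p
  rw [M.mem_P (M.ps h), arcR] at hx hz hx' hz' hy
  rw [M.mem_P (M.ps h), M.mem_P (M.ps h), arcR, arcR]
  rw [hs] at hx hz f1 ⊢
  grind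

lemma wheel_hub (n : ℕ) (i : Fin n) : (wheel n).Adj (.inr ()) (.inl i) := by
  rw [wheel, SimpleGraph.fromRel_adj]; simp

lemma wheel_rim (n : ℕ) (i j : Fin n) : (wheel n).Adj (.inl i) (.inl j) ↔
    i ≠ j ∧ ((i.val + 1) % n = j.val ∨ (j.val + 1) % n = i.val) := by
  rw [wheel, SimpleGraph.fromRel_adj]; simp

lemma mod_ne {n d : ℕ} (i : ℕ) (h0 : 0 < d) (h1 : d < n) : i % n ≠ (i + d) % n := by
  intro h
  have h' : i + 0 ≡ i + d [MOD n] := h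
  have := Nat.ModEq.add_left_cancel' i h'
  rw [Nat.ModEq, Nat.zero_mod, Nat.mod_eq_of_lt h1] at this
  omega

lemma wheel_no (n : ℕ) (hn : 4 ≤ n) : ¬ IsNHCAGraph (wheel n) := by
  rintro ⟨M, hN, hH, hM⟩
  have hlt : ∀ i, i % n < n := fun i => Nat.mod_lt _ (by omega)
  obtain ⟨w, hw⟩ : ∃ w : ℕ → Fin n ⊕ Unit, ∀ i, w i = .inl ⟨i % n, hlt i⟩ := ⟨_, fun _ => rfl⟩
  have hhub : ∀ i, M.Inter (.inr ()) (w i) := fun i => by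
    rw [hw]; exact adj_inter hM (wheel_hub n _)
  have hne : ∀ i, (.inr () : Fin n ⊕ Unit) ≠ w i := fun i => by rw [hw]; simp
  have hadj : ∀ i, M.Inter (w i) (w (i+1)) := fun i => by
    apply adj_inter hM
    rw [hw, hw, wheel_rim]
    refine ⟨fun h => mod_ne i one_pos (by omega : 1 < n) (by simpa using h), Or.inl ?_⟩
    simp
  have hnadj : ∀ i, ¬ M.Inter (w i) (w (i+2)) := fun i => by
    rw [← miss_iff hM, hw, hw]
    have h2 := mod_ne i two_pos (by omega : 2 < n)
    refine ⟨fun h => h2 (by simpa using h), ?_⟩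
    rw [wheel_rim]
    rintro ⟨-, h | h⟩
    · simp only [Nat.mod_add_mod] at h
      exact mod_ne (i+1) one_pos (by omega : 1 < n) h
    · simp only [Nat.mod_add_mod] at h
      exact mod_ne i three_pos (by omega : 3 < n) h.symm
  have hp : ∀ i : Fin n, ∃ p, p ∈ M.P (.inr ()) ∧ p ∈ M.P (w i) ∧ p ∈ M.P (w (i+1)) := by
    intro i
    obtain ⟨p, hp⟩ := hH {.inr (), w i, w (i+1)} (by
      rintro u (rfl | rfl | rfl) v (rfl | rfl | rfl)
      · exact M.inter_self _
      · exact hhub _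
      · exact hhub _
      · exact M.inter_symm (hhub _)
      · exact M.inter_self _
      · exact hadj _
      · exact M.inter_symm (hhub _)
      · exact M.inter_symm (hadj _)
      · exact M.inter_self _)
    exact ⟨p, hp _ (by simp), hp _ (by simp), hp _ (by simp)⟩
  choose q hq using hp
  have : Nonempty (Fin n) := ⟨⟨0, by omega⟩⟩
  obtain ⟨k, hk⟩ := Finite.exists_min (fun i => coo (M.ps (.inr ())) (q i))
  obtain ⟨p, hpd⟩ : ∃ p : ℕ → Circ, ∀ i, p i = q ⟨i % n, hlt i⟩ := ⟨_, fun _ => rfl⟩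
  have hmod : ∀ i, w (i % n) = w i := fun i => by rw [hw, hw]; simp
  have hmod1 : ∀ i, w (i % n + 1) = w (i+1) := fun i => by rw [hw, hw]; simp
  have hp1 : ∀ i, p i ∈ M.P (.inr ()) := fun i => by rw [hpd]; exact (hq _).1
  have hp2 : ∀ i, p i ∈ M.P (w i) := fun i => by
    rw [hpd, ← hmod i]; exact (hq _).2.1
  have hp3 : ∀ i, p i ∈ M.P (w (i+1)) := fun i => by
    rw [hpd, ← hmod1 i]; exact (hq _).2.2
  obtain ⟨j, hj⟩ : ∃ j, ∀ i, coo (M.ps (.inr ())) (p (j+1)) ≤ coo (M.ps (.inr ())) (p i) := by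
    refine ⟨k.val + n - 1, fun i => ?_⟩
    have e : (k.val + n - 1 + 1) % n = k.val := by
      have : k.val + n - 1 + 1 = k.val + n := by omega
      rw [this, Nat.add_mod_right, Nat.mod_eq_of_lt k.2]
    have e' : p (k.val + n - 1 + 1) = q k := by
      rw [hpd]; congr 1; exact Fin.ext e
    rw [e', hpd]
    exact hk _
  rcases le_total (coo (M.ps (.inr ())) (p j)) (coo (M.ps (.inr ())) (p (j+2))) with h | h
  · have := normal_convex hN (hne (j+2)) (hp1 (j+1)) (hp1 (j+2)) (hp3 (j+1)) (hp2 (j+2)) (hj j) h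
    exact hnadj j ⟨p j, hp2 j, this⟩
  · have := normal_convex hN (hne (j+1)) (hp1 (j+1)) (hp1 j) (hp2 (j+1)) (hp3 j) (hj (j+2)) h
    exact hnadj (j+1) ⟨p (j+2), this, hp3 (j+2)⟩

end forward

/-- An HCA graph is an NHCA graph iff it contains no induced wheel `W_n`
(`n ≥ 4`), 3-sun, rising sun `R_n` (`n ≥ 4`), or umbrella. -/
theorem stmt_5 {V : Type} [Fintype V] (G : SimpleGraph V) (hG : IsHCAGraph G) :
    IsNHCAGraph G ↔
      ((∀ n : ℕ, 4 ≤ n → IsEmpty (wheel n ↪g G)) ∧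
       IsEmpty (sun3 ↪g G) ∧
       (∀ n : ℕ, 4 ≤ n → IsEmpty (risingSun n ↪g G)) ∧
       IsEmpty (umbrella ↪g G)) := by
  constructor
  · intro h
    exact ⟨fun n hn => ⟨fun φ => wheel_no n hn (nhca_comap h φ)⟩,
      ⟨fun φ => sun3_no (nhca_comap h φ)⟩,
      fun n hn => ⟨fun φ => rising_no n hn (nhca_comap h φ)⟩,
      ⟨fun φ => umbrella_no (nhca_comap h φ)⟩⟩
  · rintro ⟨hW, hS, hR, hU⟩
    obtain ⟨M, hH, hM⟩ := hG
    by_cases hh : NoHole G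
    · obtain ⟨k, Q, hQ⟩ := exists_rep hh (fun a b c h => noAT hM hH hh hS hR hU h) _ Set.univ rfl
      exact nhca_of_rep hQ
    · unfold NoHole at hh
      push Not at hh
      obtain ⟨n, u, hu⟩ := hh
      exact ⟨M, fun A B _ hc => hole_normal hM hW hu (M.cov_iff_union.2 hc), hH, hM⟩
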